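/- arXiv:2605.10595 — 6 statements merged into one kernel-verified Lean document; each statement's English description precedes it below -/
import Mathlib

section
/- In the setting of the one-step Frank–Wolfe map on B_p ⊂ ℝ² for f(x) = ‖x - e₁‖₂² in (u,w) coordinates, assume w ≠ 0 and define P = |w|(1 - v₁) + u·|v₂| > 0. Then the new coordinates satisfy u' = |d₂|·P/(d₁² + d₂²) and |w'| = |d₁|·P/(d₁² + d₂²); consequently, if d₁ ≠ 0 then w' ≠ 0 and the new ratio satisfies |w'|/u' = |d₁|/|d₂|. -/
/-!
STATEMENT 3: Ratio identity for one Frank–Wolfe step on B_p ⊂ ℝ² in (u,w)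
coordinates: with P = |w|(1-v₁)+u|v₂| > 0 one has u' = |d₂|P/(d₁²+d₂²),
|w'| = |d₁|P/(d₁²+d₂²); if d₁ ≠ 0 then w' ≠ 0 and |w'|/u' = |d₁|/|d₂|.
-/

noncomputable section
open Real

namespace Stmt3

/-- Hölder conjugate q = p/(p-1). -/
def qc (p : ℝ) : ℝ := p / (p - 1)

/-- α = (p-1)/p = 1/q. -/
def alphac (p : ℝ) : ℝ := (p - 1) / p

/-- M = (u^q + |w|^q)^{1/q}. -/
def Mv (p u w : ℝ) : ℝ := (u ^ qc p + |w| ^ qc p) ^ (1 / qc p)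

/-- First coordinate of the LMO output: v₁ = u^{q-1}/M^{q-1}. -/
def v1f (p u w : ℝ) : ℝ := u ^ (qc p - 1) / Mv p u w ^ (qc p - 1)

/-- Second coordinate of the LMO output: v₂ = -sign(w)·|w|^{q-1}/M^{q-1}. -/
def v2f (p u w : ℝ) : ℝ := -(Real.sign w) * |w| ^ (qc p - 1) / Mv p u w ^ (qc p - 1)

/-- d₁ = v₁ - 1 + u. -/
def d1f (p u w : ℝ) : ℝ := v1f p u w - 1 + u

/-- d₂ = v₂ - w. -/
def d2f (p u w : ℝ) : ℝ := v2f p u w - w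

/-- Exact line-search step size γ = (M - u + u² + w²)/(d₁² + d₂²). -/
def gamf (p u w : ℝ) : ℝ :=
  (Mv p u w - u + u ^ 2 + w ^ 2) / (d1f p u w ^ 2 + d2f p u w ^ 2)

/-- u' = u - γ·d₁. -/
def uN (p u w : ℝ) : ℝ := u - gamf p u w * d1f p u w

/-- w' = w + γ·d₂. -/
def wN (p u w : ℝ) : ℝ := w + gamf p u w * d2f p u w

/-- Scaled one-step map Φ(u,y) = |w'|/(u')^{1+α} where w = y·u^{1+α}. -/
def Phi (p u y : ℝ) : ℝ :=
  |wN p u (y * u ^ (1 + alphac p))| /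
    (uN p u (y * u ^ (1 + alphac p))) ^ (1 + alphac p)

/-- C_p = (p/(p+1))^{1/q}. -/
def Cp (p : ℝ) : ℝ := (p / (p + 1)) ^ (1 / qc p)

/-- D_p = C_p·(p-1)(3p+1)/(2p(p+1)²). -/
def Dp (p : ℝ) : ℝ := Cp p * ((p - 1) * (3 * p + 1)) / (2 * p * (p + 1) ^ 2)

lemma abs_sign {w : ℝ} (hw : w ≠ 0) : |Real.sign w| = 1 := by
  rcases Real.sign_apply_eq_of_ne_zero w hw with h | h <;> simp [h]

lemma eq_sign_mul_abs (w : ℝ) : w = Real.sign w * |w| := by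
  rcases lt_trichotomy w 0 with h | rfl | h
  · rw [Real.sign_of_neg h, abs_of_neg h]; ring
  · simp
  · rw [Real.sign_of_pos h, abs_of_pos h]; ring

lemma one_lt_qc {p : ℝ} (hp : 1 < p) : 1 < qc p := by
  rw [qc, one_lt_div (by linarith)]
  linarith

lemma Mv_pos (p : ℝ) {u : ℝ} (w : ℝ) (hu : 0 < u) : 0 < Mv p u w := by
  unfold Mv
  positivity

lemma Mv_rpow_qc {p : ℝ} (hp : 1 < p) {u : ℝ} (w : ℝ) (hu : 0 < u) :
    Mv p u w ^ qc p = u ^ qc p + |w| ^ qc p := by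
  have hq := one_lt_qc hp
  rw [Mv, ← Real.rpow_mul (by positivity), one_div_mul_cancel (by linarith), Real.rpow_one]

lemma le_Mv {p : ℝ} (hp : 1 < p) {u : ℝ} (w : ℝ) (hu : 0 < u) : u ≤ Mv p u w := by
  have hq := one_lt_qc hp
  rw [← Real.rpow_le_rpow_iff hu.le (Mv_pos p w hu).le (by linarith : 0 < qc p),
    Mv_rpow_qc hp w hu]
  exact le_add_of_nonneg_right (by positivity)

lemma v1f_le_one {p : ℝ} (hp : 1 < p) {u : ℝ} (w : ℝ) (hu : 0 < u) : v1f p u w ≤ 1 := by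
  have hq := one_lt_qc hp
  rw [v1f, div_le_one (Real.rpow_pos_of_pos (Mv_pos p w hu) _)]
  exact Real.rpow_le_rpow hu.le (le_Mv hp w hu) (by linarith)

lemma v2f_eq (p u w : ℝ) :
    v2f p u w = -(Real.sign w) * (|w| ^ (qc p - 1) / Mv p u w ^ (qc p - 1)) :=
  mul_div_assoc _ _ _

lemma abs_v2f {p u w : ℝ} (hu : 0 < u) (hw : w ≠ 0) :
    |v2f p u w| = |w| ^ (qc p - 1) / Mv p u w ^ (qc p - 1) := by
  have hM := Mv_pos p w hu
  rw [v2f_eq, abs_mul, abs_neg, abs_sign hw, one_mul, abs_of_nonneg (by positivity)]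

lemma abs_v2f_pos {p u w : ℝ} (hu : 0 < u) (hw : w ≠ 0) : 0 < |v2f p u w| := by
  have hM := Mv_pos p w hu
  rw [abs_v2f hu hw]
  positivity

lemma Mv_eq_dot {p : ℝ} (hp : 1 < p) {u w : ℝ} (hu : 0 < u) (hw : w ≠ 0) :
    Mv p u w = u * v1f p u w + |w| * |v2f p u w| := by
  have hM := Mv_pos p w hu
  have hMq := Real.rpow_pos_of_pos hM (qc p - 1)
  have key {x : ℝ} (hx : 0 < x) : x * x ^ (qc p - 1) = x ^ qc p := by
    rw [← Real.rpow_one_add' hx.le (by have := one_lt_qc hp; linarith)]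
    ring_nf
  rw [abs_v2f hu hw, v1f, ← mul_div_assoc, ← mul_div_assoc, key hu, key (abs_pos.mpr hw),
    ← add_div, ← Mv_rpow_qc hp w hu, eq_div_iff hMq.ne', key hM]

lemma abs_d2f {p u w : ℝ} (hu : 0 < u) (hw : w ≠ 0) :
    |d2f p u w| = |v2f p u w| + |w| := by
  have hV : 0 < |w| ^ (qc p - 1) / Mv p u w ^ (qc p - 1) := abs_v2f hu hw ▸ abs_v2f_pos hu hw
  rw [abs_v2f hu hw, d2f, v2f_eq]
  rcases lt_or_gt_of_ne hw with h | h
  · rw [Real.sign_of_neg h, abs_of_nonneg (by linarith)]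
    linarith [abs_of_neg h]
  · rw [Real.sign_of_pos h, abs_of_nonpos (by linarith)]
    linarith [abs_of_pos h]

lemma d2f_eq_neg_sign_mul {p u w : ℝ} (hu : 0 < u) (hw : w ≠ 0) :
    d2f p u w = -(Real.sign w) * |d2f p u w| := by
  rw [abs_d2f hu hw, abs_v2f hu hw, d2f, v2f_eq]
  linear_combination -eq_sign_mul_abs w

theorem ratio_identity (p : ℝ) (hp : 1 < p) (u w : ℝ) (hu : 0 < u) (hw : w ≠ 0) :
    0 < |w| * (1 - v1f p u w) + u * |v2f p u w| ∧
    uN p u w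
      = |d2f p u w| * (|w| * (1 - v1f p u w) + u * |v2f p u w|)
          / (d1f p u w ^ 2 + d2f p u w ^ 2) ∧
    |wN p u w|
      = |d1f p u w| * (|w| * (1 - v1f p u w) + u * |v2f p u w|)
          / (d1f p u w ^ 2 + d2f p u w ^ 2) ∧
    (d1f p u w ≠ 0 →
      wN p u w ≠ 0 ∧ |wN p u w| / uN p u w = |d1f p u w| / |d2f p u w|) := by
  have hV : 0 < |v2f p u w| := abs_v2f_pos hu hw
  have hv := v1f_le_one hp w hu
  have ha : 0 < |w| := abs_pos.mpr hw
  have hM := Mv_eq_dot hp hu hw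
  have hd := abs_d2f (p := p) hu hw
  have hsd := d2f_eq_neg_sign_mul (p := p) hu hw
  have hd1 : d1f p u w = v1f p u w - 1 + u := rfl
  have hd2 : 0 < |d2f p u w| := by linarith
  have hD : 0 < d1f p u w ^ 2 + d2f p u w ^ 2 := by
    rw [← sq_abs (d2f p u w)]
    positivity
  have hP : 0 < |w| * (1 - v1f p u w) + u * |v2f p u w| :=
    add_pos_of_nonneg_of_pos (mul_nonneg ha.le (by linarith)) (mul_pos hu hV)
  have hg : gamf p u w * (d1f p u w ^ 2 + d2f p u w ^ 2)
      = u * d1f p u w + |w| * |d2f p u w| := by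
    rw [gamf, div_mul_cancel₀ _ hD.ne', hM, ← sq_abs w, hd1, hd]
    ring
  have hu' : uN p u w
      = |d2f p u w| * (|w| * (1 - v1f p u w) + u * |v2f p u w|)
          / (d1f p u w ^ 2 + d2f p u w ^ 2) := by
    rw [eq_div_iff hD.ne', uN, sub_mul, mul_right_comm, hg, ← sq_abs (d2f p u w), hd, hd1]
    ring
  have hsw := eq_sign_mul_abs w
  have hw' : |wN p u w|
      = |d1f p u w| * (|w| * (1 - v1f p u w) + u * |v2f p u w|)
          / (d1f p u w ^ 2 + d2f p u w ^ 2) := by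
    have h : wN p u w * (d1f p u w ^ 2 + d2f p u w ^ 2)
        = -Real.sign w * (d1f p u w * (|w| * (1 - v1f p u w) + u * |v2f p u w|)) := by
      rw [wN, add_mul, mul_right_comm, hg, ← sq_abs (d2f p u w)]
      linear_combination (d1f p u w ^ 2 + |d2f p u w| ^ 2) * hsw
        + (u * d1f p u w + |w| * |d2f p u w|) * hsd
        - Real.sign w * u * d1f p u w * hd + Real.sign w * |w| * d1f p u w * hd1
    rw [eq_div_iff hD.ne', ← abs_of_pos hD, ← abs_mul, h, abs_mul, abs_neg, abs_sign hw, one_mul,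
      abs_mul, abs_of_pos hP]
  refine ⟨hP, hu', hw', fun h1 => ⟨?_, ?_⟩⟩
  · have h1' := abs_pos.mpr h1
    rw [← abs_pos, hw']
    positivity
  · rw [hu', hw', div_div_div_cancel_right₀ hD.ne', mul_div_mul_right _ _ hP.ne']

end Stmt3
end
end

section
/- Fix p ≥ 3, q = p/(p-1), α = (p-1)/p, κ = 2α, and let I ⊂ (0, p^{1/q}) be compact. Let Φ(u,y) = |w'|/(u')^{1+α} denote the scaled one-step Frank–Wolfe map, where (u', w') is the image of (u, w) = (u, y·u^{1+α}) under one exact-line-search Frank–Wolfe step for f(x) = ‖x - e₁‖₂² on B_p. Then, uniformly for y ∈ I as u ↓ 0: Φ(u,y) = F(y) + u·G(y) + O(u^κ), where F(y) = y^{-(q-1)} - y/p and G(y) = y/p + ((p-1)/(2p²))·y^{q+1}. Moreover, uniformly on I, ∂Φ/∂y(u,y) = F'(y) + u·G'(y) + O(u^κ) and ∂Φ/∂u(u,y) = G(y) + O(u^{κ-1}). -/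
/-!
STATEMENT 4: First-order expansion of the scaled one-step Frank–Wolfe map
Φ(u,y) = F(y) + u·G(y) + O(u^κ), uniformly for y in a compact I ⊂ (0, p^{1/q}),
with corresponding expansions of the partial derivatives.
-/

noncomputable section
open Real

namespace Stmt4

/-- Hölder conjugate q = p/(p-1). -/
def qc (p : ℝ) : ℝ := p / (p - 1)

/-- α = (p-1)/p = 1/q. -/
def alphac (p : ℝ) : ℝ := (p - 1) / p

/-- M = (u^q + |w|^q)^{1/q}. -/
def Mv (p u w : ℝ) : ℝ := (u ^ qc p + |w| ^ qc p) ^ (1 / qc p)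

/-- First coordinate of the LMO output: v₁ = u^{q-1}/M^{q-1}. -/
def v1f (p u w : ℝ) : ℝ := u ^ (qc p - 1) / Mv p u w ^ (qc p - 1)

/-- Second coordinate of the LMO output: v₂ = -sign(w)·|w|^{q-1}/M^{q-1}. -/
def v2f (p u w : ℝ) : ℝ := -(Real.sign w) * |w| ^ (qc p - 1) / Mv p u w ^ (qc p - 1)

/-- d₁ = v₁ - 1 + u. -/
def d1f (p u w : ℝ) : ℝ := v1f p u w - 1 + u

/-- d₂ = v₂ - w. -/
def d2f (p u w : ℝ) : ℝ := v2f p u w - w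

/-- Exact line-search step size γ = (M - u + u² + w²)/(d₁² + d₂²). -/
def gamf (p u w : ℝ) : ℝ :=
  (Mv p u w - u + u ^ 2 + w ^ 2) / (d1f p u w ^ 2 + d2f p u w ^ 2)

/-- u' = u - γ·d₁. -/
def uN (p u w : ℝ) : ℝ := u - gamf p u w * d1f p u w

/-- w' = w + γ·d₂. -/
def wN (p u w : ℝ) : ℝ := w + gamf p u w * d2f p u w

/-- Scaled one-step map Φ(u,y) = |w'|/(u')^{1+α} where w = y·u^{1+α}. -/
def Phi (p u y : ℝ) : ℝ :=
  |wN p u (y * u ^ (1 + alphac p))| /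
    (uN p u (y * u ^ (1 + alphac p))) ^ (1 + alphac p)

/-- C_p = (p/(p+1))^{1/q}. -/
def Cp (p : ℝ) : ℝ := (p / (p + 1)) ^ (1 / qc p)

/-- D_p = C_p·(p-1)(3p+1)/(2p(p+1)²). -/
def Dp (p : ℝ) : ℝ := Cp p * ((p - 1) * (3 * p + 1)) / (2 * p * (p + 1) ^ 2)

/-- F(y) = y^{-(q-1)} - y/p. -/
def Ffun (p y : ℝ) : ℝ := y ^ (-(qc p - 1)) - y / p

/-- G(y) = y/p + ((p-1)/(2p²))·y^{q+1}. -/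
def Gfun (p y : ℝ) : ℝ := y / p + ((p - 1) / (2 * p ^ 2)) * y ^ (qc p + 1)

open Filter Topology

/-- The divided difference `((1 + s) ^ c - 1) / s`, extended analytically across `s = 0`. -/
def rpowSlope (c : ℝ) : ℝ → ℝ := dslope (fun s => (1 + s) ^ c) 0

lemma mul_rpowSlope (c s : ℝ) : s * rpowSlope c s = (1 + s) ^ c - 1 := by
  have h := sub_smul_dslope (fun s : ℝ => (1 + s) ^ c) 0 s
  simpa [rpowSlope] using h

lemma analyticAt_rpowSlope (c : ℝ) : AnalyticAt ℝ (rpowSlope c) 0 :=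
  ⟨_, one_add_rpow_hasFPowerSeriesAt_zero.has_fpower_series_dslope_fslope⟩

lemma hasDerivAt_one_add_rpow (c : ℝ) {s : ℝ} (hs : 0 < 1 + s) :
    HasDerivAt (fun s : ℝ => (1 + s) ^ c) (c * (1 + s) ^ (c - 1)) s := by
  simpa using ((hasDerivAt_id s).const_add 1).rpow_const (p := c) (Or.inl hs.ne')

lemma rpowSlope_zero (c : ℝ) : rpowSlope c 0 = c := by
  have h := (hasDerivAt_one_add_rpow c (s := 0) (by simp)).deriv
  simpa [rpowSlope, dslope_same] using h

lemma hasDerivAt_rpowSlope_zero (c : ℝ) :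
    HasDerivAt (rpowSlope c) (c * (c - 1) / 2) 0 := by
  have han := analyticAt_rpowSlope c
  have h0 := han.differentiableAt.hasDerivAt
  have hev : (fun s => rpowSlope c s + s * deriv (rpowSlope c) s) =ᶠ[𝓝 0]
      fun s : ℝ => c * (1 + s) ^ (c - 1) := by
    filter_upwards [han.eventually_analyticAt, lt_mem_nhds (show (-1 : ℝ) < 0 by norm_num)]
      with s hs hs1
    have h1 : HasDerivAt (fun s => s * rpowSlope c s + 1)
        (1 * rpowSlope c s + s * deriv (rpowSlope c) s) s :=
      ((hasDerivAt_id s).mul hs.differentiableAt.hasDerivAt).add_const 1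
    have h2 := hasDerivAt_one_add_rpow c (s := s) (by linarith)
    have h3 : (fun s => s * rpowSlope c s + 1) = fun s : ℝ => (1 + s) ^ c := by
      funext s
      rw [mul_rpowSlope]
      ring
    rw [h3] at h1
    rw [← h1.unique h2, one_mul]
  have h1 : HasDerivAt (fun s => rpowSlope c s + s * deriv (rpowSlope c) s)
      (deriv (rpowSlope c) 0 + (1 * deriv (rpowSlope c) 0 + 0 * deriv (deriv (rpowSlope c)) 0)) 0 :=
    h0.add ((hasDerivAt_id (0 : ℝ)).mul han.deriv.differentiableAt.hasDerivAt)
  have h2 : HasDerivAt (fun s : ℝ => c * (1 + s) ^ (c - 1)) (c * (c - 1)) 0 := by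
    simpa using (hasDerivAt_one_add_rpow (c - 1) (s := 0) (by simp)).const_mul c
  have h3 := h1.unique (hev.hasDerivAt_iff.2 h2)
  have h4 : deriv (rpowSlope c) 0 = c * (c - 1) / 2 := by linarith
  rwa [h4] at h0

/-- If `K` and `∂K/∂u` vanish on the line `u = t = 0` near `y₀`, then `K = O(u² + |t|)`
near `(0, 0, y₀)`. -/
lemma exists_bound_of_vanishing {K : ℝ × ℝ × ℝ → ℝ} {y₀ : ℝ}
    (hK : ContDiffAt ℝ 2 K (0, 0, y₀))
    (h0 : ∀ᶠ y in 𝓝 y₀, K (0, 0, y) = 0)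
    (h1 : ∀ᶠ y in 𝓝 y₀, fderiv ℝ K (0, 0, y) (1, 0, 0) = 0) :
    ∃ C > 0, ∃ r > 0, ∀ u t y : ℝ, |u| < r → |t| < r → |y - y₀| < r →
      |K (u, t, y)| ≤ C * (u ^ 2 + |t|) ∧
      |fderiv ℝ K (u, t, y) (1, 0, 0)| ≤ C * (|u| + |t|) := by
  obtain ⟨c₁, s₁, hs₁, hL₁⟩ := (hK.of_le one_le_two).exists_lipschitzOnWith
  have hd : ContDiffAt ℝ 1 (fderiv ℝ K) (0, 0, y₀) :=
    hK.fderiv_right (by norm_num [one_add_one_eq_two])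
  obtain ⟨c₂, s₂, hs₂, hL₂⟩ := hd.exists_lipschitzOnWith
  have hdiff : ∀ᶠ x in 𝓝 ((0 : ℝ), (0 : ℝ), y₀), DifferentiableAt ℝ K x :=
    (hK.eventually (by simp)).mono fun x hx => hx.differentiableAt (by simp)
  obtain ⟨r₁, hr₁, hb₁⟩ := Metric.eventually_nhds_iff.1 ((hdiff.and hs₁).and hs₂)
  obtain ⟨r₂, hr₂, hb₂⟩ := Metric.eventually_nhds_iff.1 (h0.and h1)
  have key : ∀ u t y : ℝ, |u| < min r₁ r₂ → |t| < min r₁ r₂ → |y - y₀| < min r₁ r₂ →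
      (DifferentiableAt ℝ K (u, t, y) ∧ (u, t, y) ∈ s₁) ∧ (u, t, y) ∈ s₂ := by
    intro u t y hu ht hy
    apply hb₁
    simp only [Prod.dist_eq, Real.dist_eq, sub_zero, sup_lt_iff]
    exact ⟨hu.trans_le (min_le_left _ _), ht.trans_le (min_le_left _ _),
      hy.trans_le (min_le_left _ _)⟩
  have hfd : ∀ u t y : ℝ, |u| < min r₁ r₂ → |t| < min r₁ r₂ → |y - y₀| < min r₁ r₂ →
      |fderiv ℝ K (u, t, y) (1, 0, 0)| ≤ c₂ * (|u| + |t|) := by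
    intro u t y hu ht hy
    have hz := (hb₂ (y := y) (hy.trans_le (min_le_right _ _))).2
    have h00 : |(0 : ℝ)| < min r₁ r₂ := by simpa using ⟨hr₁, hr₂⟩
    have hl := hL₂.dist_le_mul _ (key u t y hu ht hy).2 _ (key 0 0 y h00 h00 hy).2
    rw [dist_eq_norm] at hl
    have hop := (fderiv ℝ K (u, t, y) - fderiv ℝ K (0, 0, y)).le_opNorm (1, 0, 0)
    have hn : ‖((1 : ℝ), (0 : ℝ), (0 : ℝ))‖ = 1 := by simp [Prod.norm_def]
    rw [hn, mul_one, sub_apply, hz, sub_zero, Real.norm_eq_abs] at hop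
    refine hop.trans (hl.trans ?_)
    gcongr
    simp only [Prod.dist_eq, Real.dist_eq, sub_zero, sub_self, abs_zero]
    exact max_le (by linarith [abs_nonneg t]) (max_le (by linarith [abs_nonneg u]) (by positivity))
  refine ⟨c₁ + c₂ + 1, by positivity, min r₁ r₂, lt_min hr₁ hr₂, fun u t y hu ht hy => ⟨?_, ?_⟩⟩
  · have h00 : |(0 : ℝ)| < min r₁ r₂ := by simpa using ⟨hr₁, hr₂⟩
    have hKt := hL₁.dist_le_mul _ (key u t y hu ht hy).1.2 _ (key u 0 y hu h00 hy).1.2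
    have hdt : dist (u, t, y) (u, 0, y) = |t| := by
      simp [Prod.dist_eq]
    rw [hdt, Real.dist_eq] at hKt
    have hseg : ∀ v ∈ Set.uIcc 0 u, |v| ≤ |u| := fun v hv => by
      simpa using Set.abs_sub_left_of_mem_uIcc hv
    have hmv : ‖K (u, 0, y) - K (0, 0, y)‖ ≤ (c₂ * |u|) * ‖u - 0‖ := by
      refine (convex_uIcc (0 : ℝ) u).norm_image_sub_le_of_norm_hasDerivWithin_le
        (f := fun v => K (v, 0, y)) (f' := fun v => fderiv ℝ K (v, 0, y) (1, 0, 0))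
        ?_ ?_ Set.left_mem_uIcc Set.right_mem_uIcc
      · intro v hv
        have hK' := (key v 0 y ((hseg v hv).trans_lt hu) h00 hy).1.1.hasFDerivAt
        have hp : HasDerivAt (fun v : ℝ => (v, (0 : ℝ), y)) (1, 0, 0) v :=
          (hasDerivAt_id v).prodMk ((hasDerivAt_const v 0).prodMk (hasDerivAt_const v y))
        exact (hK'.comp_hasDerivAt v hp).hasDerivWithinAt
      · intro v hv
        refine (hfd v 0 y ((hseg v hv).trans_lt hu) h00 hy).trans ?_
        have := hseg v hv
        simp only [abs_zero, add_zero]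
        gcongr
    rw [(hb₂ (y := y) (hy.trans_le (min_le_right _ _))).1, sub_zero, sub_zero, Real.norm_eq_abs,
      Real.norm_eq_abs, mul_assoc, abs_mul_abs_self] at hmv
    have htri : |K (u, t, y)| ≤ |K (u, t, y) - K (u, 0, y)| + |K (u, 0, y)| := by
      simpa using abs_add_le (K (u, t, y) - K (u, 0, y)) (K (u, 0, y))
    have hc₁ : (0 : ℝ) ≤ c₁ := c₁.2
    have hc₂ : (0 : ℝ) ≤ c₂ := c₂.2
    nlinarith [abs_nonneg t, sq_nonneg u, mul_nonneg hc₁ (sq_nonneg u),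
      mul_nonneg hc₂ (abs_nonneg t)]
  · refine (hfd u t y hu ht hy).trans ?_
    have hc₁ : (0 : ℝ) ≤ c₁ := c₁.2
    gcongr
    linarith

/-- A `C³` function that vanishes together with `∂/∂u` on the line `u = t = 0` near `y₀`:
bounds for its values and its first partial derivatives near `(0, 0, y₀)`. -/
lemma exists_bounds_of_vanishing {H : ℝ × ℝ × ℝ → ℝ} {y₀ : ℝ}
    (hH : ContDiffAt ℝ 3 H (0, 0, y₀))
    (h0 : ∀ᶠ y in 𝓝 y₀, H (0, 0, y) = 0)
    (h1 : ∀ᶠ y in 𝓝 y₀, fderiv ℝ H (0, 0, y) (1, 0, 0) = 0) :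
    ∃ C > 0, ∃ r > 0, ∀ u t y : ℝ, |u| < r → |t| < r → |y - y₀| < r →
      DifferentiableAt ℝ H (u, t, y) ∧
      |H (u, t, y)| ≤ C * (u ^ 2 + |t|) ∧
      |fderiv ℝ H (u, t, y) (0, 0, 1)| ≤ C * (u ^ 2 + |t|) ∧
      |fderiv ℝ H (u, t, y) (1, 0, 0)| ≤ C * (|u| + |t|) ∧
      |fderiv ℝ H (u, t, y) (0, 1, 0)| ≤ C := by
  have hline : ∀ y : ℝ, HasDerivAt (fun y : ℝ => ((0 : ℝ), (0 : ℝ), y)) (0, 0, 1) y := fun y =>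
    (hasDerivAt_const y 0).prodMk ((hasDerivAt_const y 0).prodMk (hasDerivAt_id y))
  have hcont : Tendsto (fun y : ℝ => ((0 : ℝ), (0 : ℝ), y)) (𝓝 y₀) (𝓝 (0, 0, y₀)) :=
    (hline y₀).continuousAt
  have hev : ∀ᶠ x in 𝓝 ((0 : ℝ), (0 : ℝ), y₀), ContDiffAt ℝ 3 H x := hH.eventually (by simp)
  have hd : ContDiffAt ℝ 2 (fderiv ℝ H) (0, 0, y₀) :=
    hH.fderiv_right (by norm_num [two_add_one_eq_three])
  obtain ⟨C₁, hC₁, r₁, hr₁, hB₁⟩ :=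
    exists_bound_of_vanishing (hH.of_le (by norm_num)) h0 h1
  obtain ⟨C₂, hC₂, r₂, hr₂, hB₂⟩ :=
    exists_bound_of_vanishing (K := fun x => fderiv ℝ H x (0, 0, 1)) (y₀ := y₀)
      (hd.clm_apply contDiffAt_const)
      (by
        filter_upwards [h0.eventually_nhds, hcont.eventually hev] with y hy hHy
        have hc := (hHy.differentiableAt (by simp)).hasFDerivAt.comp_hasDerivAt y (hline y)
        exact hc.unique ((hasDerivAt_const y (0 : ℝ)).congr_of_eventuallyEq hy))
      (by
        filter_upwards [h1.eventually_nhds, hcont.eventually hev] with y hy hHy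
        have hd' : DifferentiableAt ℝ (fderiv ℝ H) (0, 0, y) :=
          (hHy.fderiv_right (m := 2) (by norm_num [two_add_one_eq_three])).differentiableAt
            (by simp)
        have hsymm := (hHy.isSymmSndFDerivAt (by simp; norm_num)) (1, 0, 0) (0, 0, 1)
        have hg : HasFDerivAt (fun x => fderiv ℝ H x (0, 0, 1))
            ((fderiv ℝ (fderiv ℝ H) (0, 0, y)).flip (0, 0, 1)) (0, 0, y) := by
          simpa using hd'.hasFDerivAt.clm_apply (hasFDerivAt_const ((0 : ℝ), (0 : ℝ), (1 : ℝ)) _)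
        have hg' : HasFDerivAt (fun x => fderiv ℝ H x (1, 0, 0))
            ((fderiv ℝ (fderiv ℝ H) (0, 0, y)).flip (1, 0, 0)) (0, 0, y) := by
          simpa using hd'.hasFDerivAt.clm_apply (hasFDerivAt_const ((1 : ℝ), (0 : ℝ), (0 : ℝ)) _)
        have hc := hg'.comp_hasDerivAt y (hline y)
        replace hc := hc.unique ((hasDerivAt_const y (0 : ℝ)).congr_of_eventuallyEq hy)
        rw [hg.fderiv, ContinuousLinearMap.flip_apply, hsymm]
        simpa using hc)
  have hbd : ∀ᶠ x in 𝓝 ((0 : ℝ), (0 : ℝ), y₀), |fderiv ℝ H x (0, 1, 0)| <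
      |fderiv ℝ H (0, 0, y₀) (0, 1, 0)| + 1 :=
    ((hd.continuousAt.clm_apply continuousAt_const).abs).eventually_lt continuousAt_const
      (by simp)
  obtain ⟨r₃, hr₃, hB₃⟩ := Metric.eventually_nhds_iff.1 (hev.and hbd)
  refine ⟨C₁ + C₂ + (|fderiv ℝ H (0, 0, y₀) (0, 1, 0)| + 1), by positivity,
    min r₁ (min r₂ r₃), by positivity, fun u t y hu ht hy => ?_⟩
  simp only [lt_min_iff] at hu ht hy
  obtain ⟨hb1, hb2⟩ := hB₁ u t y hu.1 ht.1 hy.1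
  obtain ⟨hb3, -⟩ := hB₂ u t y hu.2.1 ht.2.1 hy.2.1
  obtain ⟨hb4, hb5⟩ := hB₃ (y := (u, t, y)) (by
    simp only [Prod.dist_eq, Real.dist_eq, sub_zero, sup_lt_iff]
    exact ⟨hu.2.2, ht.2.2, hy.2.2⟩)
  have hA := abs_nonneg (fderiv ℝ H (0, 0, y₀) (0, 1, 0))
  refine ⟨hb4.differentiableAt (by simp), hb1.trans ?_, hb3.trans ?_, hb2.trans ?_, ?_⟩
  · gcongr
    linarith
  · gcongr
    linarith
  · gcongr
    linarith
  · linarith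

/-! In the variables `x = (u, t, y)` with `t = u ^ (2α)`, the scaled map extends to a smooth
function near `u = t = 0`. -/

/-- The scaled line-search numerator `(M - u + u² + w²) / u²`. -/
def scaledNum (p : ℝ) (x : ℝ × ℝ × ℝ) : ℝ :=
  x.2.2 ^ qc p * rpowSlope (alphac p) (x.2.2 ^ qc p * x.1) + 1 + x.2.2 ^ 2 * x.2.1

/-- The scaled first direction component `d₁ / u`. -/
def scaledD1 (p : ℝ) (x : ℝ × ℝ × ℝ) : ℝ :=
  x.2.2 ^ qc p * rpowSlope (-(1 / p)) (x.2.2 ^ qc p * x.1) + 1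

/-- The scaled second direction component `-d₂ / u ^ (1 / p)`. -/
def scaledD2 (p : ℝ) (x : ℝ × ℝ × ℝ) : ℝ :=
  x.2.2 ^ (qc p - 1) * (1 + x.2.2 ^ qc p * x.1) ^ (-(1 / p)) + x.2.2 * x.2.1

/-- The scaled line-search denominator `(d₁² + d₂²) / u ^ (2 / p)`. -/
def scaledDen (p : ℝ) (x : ℝ × ℝ × ℝ) : ℝ :=
  scaledD2 p x ^ 2 + x.2.1 * scaledD1 p x ^ 2

/-- The scaled second coordinate `-w' / u ^ (1 + α)`. -/
def scaledW (p : ℝ) (x : ℝ × ℝ × ℝ) : ℝ :=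
  scaledNum p x * scaledD2 p x / scaledDen p x - x.2.2

/-- The scaled first coordinate `u' / u`. -/
def scaledU (p : ℝ) (x : ℝ × ℝ × ℝ) : ℝ :=
  1 - x.2.1 * (scaledNum p x * scaledD1 p x / scaledDen p x)

/-- The smooth extension of `Phi`. -/
def PhiExt (p : ℝ) (x : ℝ × ℝ × ℝ) : ℝ :=
  scaledW p x / scaledU p x ^ (1 + alphac p)

lemma Phi_eq_PhiExt {p u y : ℝ} (hp : 3 ≤ p) (hu : 0 < u) (hy : 0 < y)
    (hW : 0 < scaledW p (u, u ^ (2 * alphac p), y))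
    (hU : 0 < scaledU p (u, u ^ (2 * alphac p), y)) :
    Phi p u y = PhiExt p (u, u ^ (2 * alphac p), y) := by
  have hp0 : p ≠ 0 := by linarith
  have hp1 : p - 1 ≠ 0 := by linarith
  set t := u ^ (2 * alphac p) with ht
  set x : ℝ × ℝ × ℝ := (u, t, y) with hx
  set b := u ^ (1 / p) with hb
  have hb0 : 0 < b := by positivity
  have ht0 : 0 < t := by positivity
  have htb : t * b = u ^ (1 + alphac p) := by
    rw [ht, hb, ← rpow_add hu]
    congr 1
    unfold alphac
    field_simp
    ring
  have htbb : t * b ^ 2 = u ^ 2 := by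
    rw [sq, ← mul_assoc, htb, hb, ← rpow_add hu, ← rpow_natCast]
    congr 1
    unfold alphac
    field_simp
    push_cast
    ring
  set s := y ^ qc p * u with hs
  have hs0 : 0 < s := by positivity
  have hw0 : 0 < y * u ^ (1 + alphac p) := by positivity
  have hM : Mv p u (y * u ^ (1 + alphac p)) = u * (1 + s) ^ alphac p := by
    have h1 : u ^ qc p + |y * u ^ (1 + alphac p)| ^ qc p = u ^ qc p * (1 + s) := by
      rw [abs_of_pos hw0, mul_rpow hy.le (by positivity), ← rpow_mul hu.le,
        show (1 + alphac p) * qc p = qc p + 1 by unfold alphac qc; field_simp,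
        rpow_add hu, rpow_one]
      ring
    rw [Mv, h1, mul_rpow (by positivity) (by positivity), ← rpow_mul hu.le,
      show qc p * (1 / qc p) = 1 by unfold qc; field_simp,
      show 1 / qc p = alphac p by unfold qc alphac; field_simp, rpow_one]
  have hMq : Mv p u (y * u ^ (1 + alphac p)) ^ (qc p - 1) =
      u ^ (qc p - 1) * (1 + s) ^ (1 / p) := by
    rw [hM, mul_rpow hu.le (by positivity), ← rpow_mul (by positivity),
      show alphac p * (qc p - 1) = 1 / p by unfold alphac qc; field_simp; ring]
  have huq : 0 < u ^ (qc p - 1) := by positivity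
  have hsp : 0 < (1 + s) ^ (1 / p) := by positivity
  have hv1 : v1f p u (y * u ^ (1 + alphac p)) = (1 + s) ^ (-(1 / p)) := by
    rw [v1f, hMq, rpow_neg (by positivity)]
    field_simp
  have hv2 : v2f p u (y * u ^ (1 + alphac p)) =
      -(y ^ (qc p - 1) * b * (1 + s) ^ (-(1 / p))) := by
    have h1 : (y * u ^ (1 + alphac p)) ^ (qc p - 1) = y ^ (qc p - 1) * (u ^ (qc p - 1) * b) := by
      rw [mul_rpow hy.le (by positivity), ← rpow_mul hu.le, hb, ← rpow_add hu]
      congr 2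
      unfold alphac qc
      field_simp
      ring
    rw [v2f, hMq, Real.sign_of_pos hw0, abs_of_pos hw0, h1, rpow_neg (by positivity)]
    field_simp
  have hd1 : d1f p u (y * u ^ (1 + alphac p)) = u * scaledD1 p x := by
    have h1 := mul_rpowSlope (-(1 / p)) s
    have h2 : scaledD1 p x = y ^ qc p * rpowSlope (-(1 / p)) s + 1 := rfl
    rw [d1f, hv1, h2]
    linear_combination -h1 + rpowSlope (-(1 / p)) s * hs
  have hd2 : d2f p u (y * u ^ (1 + alphac p)) = -(b * scaledD2 p x) := by
    have h2 : scaledD2 p x = y ^ (qc p - 1) * (1 + s) ^ (-(1 / p)) + y * t := rfl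
    rw [d2f, hv2, h2, ← htb]
    ring
  have hN : Mv p u (y * u ^ (1 + alphac p)) - u + u ^ 2 + (y * u ^ (1 + alphac p)) ^ 2 =
      u ^ 2 * scaledNum p x := by
    have h1 := mul_rpowSlope (alphac p) s
    have h2 : scaledNum p x = y ^ qc p * rpowSlope (alphac p) s + 1 + y ^ 2 * t := rfl
    rw [hM, h2, ← htb]
    linear_combination (-u) * h1 + u * rpowSlope (alphac p) s * hs + y ^ 2 * t * htbb
  have hgam : gamf p u (y * u ^ (1 + alphac p)) = t * (scaledNum p x / scaledDen p x) := by
    have h1 : (u * scaledD1 p x) ^ 2 + (-(b * scaledD2 p x)) ^ 2 = b ^ 2 * scaledDen p x := by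
      have h2 : scaledDen p x = scaledD2 p x ^ 2 + t * scaledD1 p x ^ 2 := rfl
      rw [h2]
      linear_combination -(scaledD1 p x ^ 2) * htbb
    rw [gamf, hN, hd1, hd2, h1, ← htbb]
    field_simp
  have huN : uN p u (y * u ^ (1 + alphac p)) = u * scaledU p x := by
    have h2 : scaledU p x = 1 - t * (scaledNum p x * scaledD1 p x / scaledDen p x) := rfl
    rw [uN, hgam, hd1, h2]
    ring
  have hwN : wN p u (y * u ^ (1 + alphac p)) = -(u ^ (1 + alphac p) * scaledW p x) := by
    have h2 : scaledW p x = scaledNum p x * scaledD2 p x / scaledDen p x - y := rfl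
    rw [wN, hgam, hd2, h2, ← htb]
    ring
  rw [Phi, huN, hwN, abs_neg, abs_of_pos (by positivity), mul_rpow hu.le hU.le, PhiExt]
  have := rpow_pos_of_pos hU (1 + alphac p)
  field_simp

lemma scaledD2_line {p y : ℝ} : scaledD2 p (0, 0, y) = y ^ (qc p - 1) := by
  simp [scaledD2]

lemma scaledDen_line {p y : ℝ} : scaledDen p (0, 0, y) = (y ^ (qc p - 1)) ^ 2 := by
  simp [scaledDen, scaledD2_line]

lemma rpow_qc {p y : ℝ} (hy : 0 < y) : y ^ qc p = y ^ (qc p - 1) * y := by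
  rw [← rpow_add_one hy.ne']
  ring_nf

lemma scaledW_line {p y : ℝ} (hp : 3 ≤ p) (hy : 0 < y) : scaledW p (0, 0, y) = Ffun p y := by
  have ha : 0 < y ^ (qc p - 1) := by positivity
  have hp0 : p ≠ 0 := by linarith
  simp only [scaledW, scaledD2_line, scaledDen_line, scaledNum, mul_zero, add_zero, rpowSlope_zero,
    Ffun, rpow_neg hy.le]
  rw [rpow_qc hy]
  unfold alphac
  field_simp
  ring

lemma Ffun_pos {p y : ℝ} (hp : 3 ≤ p) (hy : 0 < y) (hyp : y < p ^ (1 / qc p)) :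
    0 < Ffun p y := by
  have hq : 0 < qc p := div_pos (by linarith) (by linarith)
  have h1 : y ^ qc p < p := by
    have h2 := rpow_lt_rpow hy.le hyp hq
    rwa [← rpow_mul (by linarith), one_div_mul_cancel hq.ne', rpow_one] at h2
  have ha : 0 < y ^ (qc p - 1) := by positivity
  rw [rpow_qc hy] at h1
  rw [Ffun, rpow_neg hy.le, sub_pos, inv_eq_one_div, div_lt_div_iff₀ (by linarith) ha]
  linarith

lemma scaledU_line {p y : ℝ} : scaledU p (0, 0, y) = 1 := by
  simp [scaledU]

lemma PhiExt_line {p y : ℝ} (hp : 3 ≤ p) (hy : 0 < y) : PhiExt p (0, 0, y) = Ffun p y := by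
  rw [PhiExt, scaledU_line, scaledW_line hp hy, one_rpow, div_one]

section Smooth

variable {p y₀ : ℝ}

lemma contDiffAt_coord (x : ℝ × ℝ × ℝ) :
    ContDiffAt ℝ 3 (fun x : ℝ × ℝ × ℝ => x.1) x ∧
    ContDiffAt ℝ 3 (fun x : ℝ × ℝ × ℝ => x.2.1) x ∧
    ContDiffAt ℝ 3 (fun x : ℝ × ℝ × ℝ => x.2.2) x :=
  ⟨contDiffAt_fst, contDiffAt_fst.comp x contDiffAt_snd, contDiffAt_snd.comp x contDiffAt_snd⟩

lemma contDiffAt_rpowSlope_comp (c : ℝ) (hy : 0 < y₀) :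
    ContDiffAt ℝ 3 (fun x : ℝ × ℝ × ℝ => rpowSlope c (x.2.2 ^ qc p * x.1)) (0, 0, y₀) := by
  obtain ⟨h1, h2, h3⟩ := contDiffAt_coord (0, 0, y₀)
  have hs := (h3.rpow_const_of_ne (p := qc p) hy.ne').mul h1
  refine ContDiffAt.comp (g := rpowSlope c) _ ?_ hs
  simpa using (analyticAt_rpowSlope c).contDiffAt

lemma contDiffAt_scaledNum (hy : 0 < y₀) : ContDiffAt ℝ 3 (scaledNum p) (0, 0, y₀) := by
  obtain ⟨h1, h2, h3⟩ := contDiffAt_coord (0, 0, y₀)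
  exact (((h3.rpow_const_of_ne hy.ne').mul (contDiffAt_rpowSlope_comp _ hy)).add
    contDiffAt_const).add ((h3.pow 2).mul h2)

lemma contDiffAt_scaledD1 (hy : 0 < y₀) : ContDiffAt ℝ 3 (scaledD1 p) (0, 0, y₀) := by
  obtain ⟨h1, h2, h3⟩ := contDiffAt_coord (0, 0, y₀)
  exact ((h3.rpow_const_of_ne hy.ne').mul (contDiffAt_rpowSlope_comp _ hy)).add contDiffAt_const

lemma contDiffAt_scaledD2 (hy : 0 < y₀) : ContDiffAt ℝ 3 (scaledD2 p) (0, 0, y₀) := by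
  obtain ⟨h1, h2, h3⟩ := contDiffAt_coord (0, 0, y₀)
  have hs := contDiffAt_const (c := (1 : ℝ)).add
    ((h3.rpow_const_of_ne (p := qc p) hy.ne').mul h1)
  exact ((h3.rpow_const_of_ne hy.ne').mul (hs.rpow_const_of_ne (by simp))).add (h3.mul h2)

lemma contDiffAt_scaledDen (hy : 0 < y₀) : ContDiffAt ℝ 3 (scaledDen p) (0, 0, y₀) := by
  obtain ⟨h1, h2, h3⟩ := contDiffAt_coord (0, 0, y₀)
  exact ((contDiffAt_scaledD2 hy).pow 2).add (h2.mul ((contDiffAt_scaledD1 hy).pow 2))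

lemma scaledDen_line_ne_zero (hy : 0 < y₀) : scaledDen p (0, 0, y₀) ≠ 0 := by
  rw [scaledDen_line]
  positivity

lemma contDiffAt_scaledW (hy : 0 < y₀) : ContDiffAt ℝ 3 (scaledW p) (0, 0, y₀) := by
  obtain ⟨h1, h2, h3⟩ := contDiffAt_coord (0, 0, y₀)
  exact (((contDiffAt_scaledNum hy).mul (contDiffAt_scaledD2 hy)).div (contDiffAt_scaledDen hy)
    (scaledDen_line_ne_zero hy)).sub h3

lemma contDiffAt_scaledU (hy : 0 < y₀) : ContDiffAt ℝ 3 (scaledU p) (0, 0, y₀) := by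
  obtain ⟨h1, h2, h3⟩ := contDiffAt_coord (0, 0, y₀)
  exact contDiffAt_const.sub (h2.mul (((contDiffAt_scaledNum hy).mul
    (contDiffAt_scaledD1 hy)).div (contDiffAt_scaledDen hy) (scaledDen_line_ne_zero hy)))

lemma contDiffAt_PhiExt (hy : 0 < y₀) : ContDiffAt ℝ 3 (PhiExt p) (0, 0, y₀) := by
  have hU : scaledU p (0, 0, y₀) ≠ 0 := by simp [scaledU_line]
  exact (contDiffAt_scaledW hy).div ((contDiffAt_scaledU hy).rpow_const_of_ne hU)
    (by simp [scaledU_line])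

end Smooth

lemma hasDerivAt_PhiExt_line {p y : ℝ} (hp : 3 ≤ p) (hy : 0 < y) :
    HasDerivAt (fun u => PhiExt p (u, 0, y)) (Gfun p y) 0 := by
  have hp0 : p ≠ 0 := by linarith
  have ha : 0 < y ^ (qc p - 1) := by positivity
  have hlin : HasDerivAt (fun u : ℝ => y ^ qc p * u) (y ^ qc p) 0 := by
    simpa using (hasDerivAt_id (0 : ℝ)).const_mul (y ^ qc p)
  have hn : HasDerivAt (fun u => y ^ qc p * rpowSlope (alphac p) (y ^ qc p * u) + 1)
      (y ^ qc p * (alphac p * (alphac p - 1) / 2 * y ^ qc p)) 0 := by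
    refine (HasDerivAt.const_mul _
      (HasDerivAt.comp (h₂ := rpowSlope (alphac p)) 0 ?_ hlin)).add_const 1
    simpa using hasDerivAt_rpowSlope_zero (alphac p)
  have hh : HasDerivAt (fun u => y ^ (qc p - 1) * (1 + y ^ qc p * u) ^ (-(1 / p)))
      (y ^ (qc p - 1) * (-(1 / p) * y ^ qc p)) 0 := by
    refine HasDerivAt.const_mul _
      (HasDerivAt.comp (h₂ := fun s : ℝ => (1 + s) ^ (-(1 / p))) 0 ?_ hlin)
    simpa using hasDerivAt_one_add_rpow (-(1 / p)) (s := 0) (by simp)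
  have hq := (hn.div hh (by simp [ha.ne'])).sub_const y
  have hfun : (fun u => PhiExt p (u, 0, y)) = fun u =>
      (y ^ qc p * rpowSlope (alphac p) (y ^ qc p * u) + 1) /
        (y ^ (qc p - 1) * (1 + y ^ qc p * u) ^ (-(1 / p))) - y := by
    funext u
    simp only [PhiExt, scaledU, scaledW, scaledDen, scaledNum, scaledD2, zero_mul, mul_zero,
      add_zero, sub_zero, one_rpow, div_one]
    congr 1
    by_cases h : y ^ (qc p - 1) * (1 + y ^ qc p * u) ^ (-(1 / p)) = 0
    · rw [h, mul_zero, zero_div, div_zero]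
    · rw [sq, mul_div_mul_right _ _ h]
  rw [hfun]
  refine hq.congr_deriv ?_
  have hq1 : y ^ (qc p + 1) = y ^ (qc p - 1) * y ^ 2 := by
    rw [rpow_add_one hy.ne', rpow_qc hy]
    ring
  simp only [mul_zero, add_zero, one_rpow, mul_one, rpowSlope_zero, Gfun, hq1]
  rw [rpow_qc hy]
  unfold alphac
  field_simp
  ring

lemma contDiffAt_Ffun {p y : ℝ} (hy : 0 < y) : ContDiffAt ℝ 3 (Ffun p) y :=
  (contDiffAt_id.rpow_const_of_ne hy.ne').sub (contDiffAt_id.div_const p)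

lemma contDiffAt_Gfun {p y : ℝ} (hy : 0 < y) : ContDiffAt ℝ 3 (Gfun p) y :=
  (contDiffAt_id.div_const p).add (contDiffAt_const.mul (contDiffAt_id.rpow_const_of_ne hy.ne'))

/-- The error of the first-order expansion, in the variables `(u, t, y)`. -/
def remainder (p : ℝ) (x : ℝ × ℝ × ℝ) : ℝ :=
  PhiExt p x - (Ffun p x.2.2 + x.1 * Gfun p x.2.2)

lemma contDiffAt_remainder {p y : ℝ} (hy : 0 < y) : ContDiffAt ℝ 3 (remainder p) (0, 0, y) := by
  obtain ⟨h1, h2, h3⟩ := contDiffAt_coord (0, 0, y)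
  have hF : ContDiffAt ℝ 3 (fun x : ℝ × ℝ × ℝ => Ffun p x.2.2) (0, 0, y) :=
    ContDiffAt.comp (g := Ffun p) _ (contDiffAt_Ffun hy) h3
  have hG : ContDiffAt ℝ 3 (fun x : ℝ × ℝ × ℝ => Gfun p x.2.2) (0, 0, y) :=
    ContDiffAt.comp (g := Gfun p) _ (contDiffAt_Gfun hy) h3
  exact (contDiffAt_PhiExt hy).sub (hF.add (h1.mul hG))

lemma fderiv_remainder_line {p y : ℝ} (hp : 3 ≤ p) (hy : 0 < y) :
    fderiv ℝ (remainder p) (0, 0, y) (1, 0, 0) = 0 := by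
  have hline : HasDerivAt (fun u : ℝ => (u, (0 : ℝ), y)) (1, 0, 0) 0 :=
    (hasDerivAt_id _).prodMk ((hasDerivAt_const _ 0).prodMk (hasDerivAt_const _ y))
  have h1 : HasDerivAt (fun u => remainder p (u, 0, y))
      (fderiv ℝ (remainder p) (0, 0, y) (1, 0, 0)) 0 :=
    HasFDerivAt.comp_hasDerivAt (l := remainder p) 0
      ((contDiffAt_remainder hy).differentiableAt (by simp)).hasFDerivAt hline
  have h2 : HasDerivAt (fun u => remainder p (u, 0, y)) (Gfun p y - 1 * Gfun p y) 0 :=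
    (hasDerivAt_PhiExt_line hp hy).sub
      (((hasDerivAt_id (0 : ℝ)).mul_const (Gfun p y)).const_add (Ffun p y))
  rw [h1.unique h2, one_mul, sub_self]

lemma exists_local_bounds {p y₀ : ℝ} (hp : 3 ≤ p) (hy₀ : 0 < y₀) (hyp : y₀ < p ^ (1 / qc p)) :
    ∃ C > 0, ∃ r > 0, ∀ u ∈ Set.Ioo 0 r, ∀ y, |y - y₀| < r →
      |Phi p u y - (Ffun p y + u * Gfun p y)| ≤ C * u ^ (2 * alphac p) ∧
      |deriv (fun s => Phi p u s) y
          - (deriv (fun s => Ffun p s) y + u * deriv (fun s => Gfun p s) y)|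
        ≤ C * u ^ (2 * alphac p) ∧
      |deriv (fun s => Phi p s y) u - Gfun p y| ≤ C * u ^ (2 * alphac p - 1) := by
  have hα : alphac p = 1 - 1 / p := by
    unfold alphac
    rw [sub_div, div_self (by linarith)]
  have hp3 : 1 / p ≤ 1 / 3 := one_div_le_one_div_of_le (by norm_num) hp
  have hp0 : 0 < 1 / p := by positivity
  have hpos : ∀ᶠ y in 𝓝 y₀, 0 < y := lt_mem_nhds hy₀
  obtain ⟨C, hC, r₁, hr₁, hB⟩ := exists_bounds_of_vanishing (contDiffAt_remainder (p := p) hy₀)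
    (hpos.mono fun y hy => by simp [remainder, PhiExt_line hp hy])
    (hpos.mono fun y hy => fderiv_remainder_line hp hy)
  have hWU : ∀ᶠ x : ℝ × ℝ × ℝ in 𝓝 (0, 0, y₀),
      (0 < scaledW p x ∧ 0 < scaledU p x) ∧ 0 < x.2.2 := by
    refine (((contDiffAt_scaledW hy₀).continuousAt.eventually (lt_mem_nhds ?_)).and
      ((contDiffAt_scaledU hy₀).continuousAt.eventually (lt_mem_nhds ?_))).and
      ((continuous_snd.comp continuous_snd).continuousAt.eventually (lt_mem_nhds hy₀))
    · rw [scaledW_line hp hy₀]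
      exact Ffun_pos hp hy₀ hyp
    · rw [scaledU_line]
      exact one_pos
  obtain ⟨r₂, hr₂, hB₂⟩ := Metric.eventually_nhds_iff.1 hWU
  have hsmall : ∀ u ∈ Set.Ioo 0 (min 1 (min r₁ r₂)), u ^ (2 * alphac p) ≤ u := fun u hu => by
    have := rpow_le_rpow_of_exponent_ge hu.1 (hu.2.trans_le (min_le_left _ _)).le
      (show 1 ≤ 2 * alphac p by linarith)
    rwa [rpow_one] at this
  have hnear : ∀ u ∈ Set.Ioo 0 (min 1 (min r₁ r₂)), ∀ y, |y - y₀| < min 1 (min r₁ r₂) →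
      0 < y ∧ Phi p u y = PhiExt p (u, u ^ (2 * alphac p), y) := fun u hu y hy => by
    have hu2 := hu.2
    have hs := hsmall u hu
    have ht : 0 < u ^ (2 * alphac p) := rpow_pos_of_pos hu.1 _
    simp only [lt_min_iff] at hy hu2
    obtain ⟨⟨hW, hU⟩, hy0⟩ := hB₂ (y := (u, u ^ (2 * alphac p), y)) (by
      simp only [Prod.dist_eq, Real.dist_eq, sub_zero, sup_lt_iff, abs_of_pos hu.1, abs_of_pos ht]
      exact ⟨hu2.2.2, hs.trans_lt hu2.2.2, hy.2.2⟩)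
    exact ⟨hy0, Phi_eq_PhiExt hp hu.1 hy0 hW hU⟩
  refine ⟨4 * C, by positivity, min 1 (min r₁ r₂), by positivity, fun u hu y hy => ?_⟩
  obtain ⟨hy0, hΦ⟩ := hnear u hu y hy
  have hu0 := hu.1
  have hs := hsmall u hu
  have hu2 := hu.2
  have hy2 := hy
  simp only [lt_min_iff] at hu2 hy2
  set t := u ^ (2 * alphac p) with ht_def
  have ht : 0 < t := rpow_pos_of_pos hu0 _
  obtain ⟨hd, hb1, hb2, hb3, hb4⟩ := hB u t y (by rw [abs_of_pos hu0]; exact hu2.2.1)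
    (by rw [abs_of_pos ht]; exact hs.trans_lt hu2.2.1) hy2.2.1
  rw [abs_of_pos ht] at hb1 hb2 hb3
  rw [abs_of_pos hu0] at hb3
  have hut : u ^ 2 ≤ t := by
    have := rpow_le_rpow_of_exponent_ge hu0 hu2.1.le (show 2 * alphac p ≤ (2 : ℕ) by
      push_cast; linarith)
    rwa [rpow_natCast] at this
  have hut1 : u ≤ u ^ (2 * alphac p - 1) := by
    have := rpow_le_rpow_of_exponent_ge hu0 hu2.1.le (show 2 * alphac p - 1 ≤ 1 by linarith)
    rwa [rpow_one] at this
  have hCt : C * (u ^ 2 + t) ≤ 4 * C * t := by nlinarith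
  refine ⟨?_, ?_, ?_⟩
  · rw [hΦ]
    exact hb1.trans hCt
  · have hline : HasDerivAt (fun s : ℝ => (u, t, s)) (0, 0, 1) y :=
      (hasDerivAt_const _ _).prodMk ((hasDerivAt_const _ _).prodMk (hasDerivAt_id _))
    have h1 : HasDerivAt (fun s => remainder p (u, t, s))
        (fderiv ℝ (remainder p) (u, t, y) (0, 0, 1)) y :=
      HasFDerivAt.comp_hasDerivAt (l := remainder p) y hd.hasFDerivAt hline
    have hF := ((contDiffAt_Ffun (p := p) hy0).differentiableAt (by simp)).hasDerivAt
    have hG := ((contDiffAt_Gfun (p := p) hy0).differentiableAt (by simp)).hasDerivAt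
    have hev : (fun s => Phi p u s) =ᶠ[𝓝 y]
        fun s => remainder p (u, t, s) + (Ffun p s + u * Gfun p s) := by
      have hnhds : ∀ᶠ s in 𝓝 y, |s - y₀| < min 1 (min r₁ r₂) :=
        ((continuous_id.sub continuous_const).abs.continuousAt (x := y)).eventually
          (gt_mem_nhds hy)
      filter_upwards [hnhds] with s hs'
      rw [(hnear u hu s hs').2]
      simp [remainder, ht_def]
    rw [((h1.add (hF.add (hG.const_mul u))).congr_of_eventuallyEq hev).deriv, add_sub_cancel_right]
    exact hb2.trans hCt
  · have hpow : HasDerivAt (fun s : ℝ => s ^ (2 * alphac p))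
        (2 * alphac p * u ^ (2 * alphac p - 1)) u := hasDerivAt_rpow_const (Or.inl hu0.ne')
    have hcurve : HasDerivAt (fun s : ℝ => (s, s ^ (2 * alphac p), y))
        (1, 2 * alphac p * u ^ (2 * alphac p - 1), 0) u :=
      (hasDerivAt_id _).prodMk (hpow.prodMk (hasDerivAt_const _ _))
    have h1 : HasDerivAt (fun s => remainder p (s, s ^ (2 * alphac p), y))
        (fderiv ℝ (remainder p) (u, t, y) (1, 2 * alphac p * u ^ (2 * alphac p - 1), 0)) u :=
      HasFDerivAt.comp_hasDerivAt (l := remainder p) u hd.hasFDerivAt hcurve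
    have hev : (fun s => Phi p s y) =ᶠ[𝓝 u]
        fun s => remainder p (s, s ^ (2 * alphac p), y) + (Ffun p y + s * Gfun p y) := by
      filter_upwards [Ioo_mem_nhds hu.1 hu.2] with s hs'
      rw [(hnear s hs' y hy).2]
      simp [remainder]
    have h2 := ((hasDerivAt_id u).mul_const (Gfun p y)).const_add (Ffun p y)
    rw [((h1.add h2).congr_of_eventuallyEq hev).deriv, one_mul, add_sub_cancel_right]
    have hdec : ((1 : ℝ), 2 * alphac p * u ^ (2 * alphac p - 1), (0 : ℝ)) =
        (1, 0, 0) + (2 * alphac p * u ^ (2 * alphac p - 1)) • ((0 : ℝ), (1 : ℝ), (0 : ℝ)) := by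
      simp
    rw [hdec, map_add, map_smul, smul_eq_mul]
    refine (abs_add_le _ _).trans ?_
    have hv : 0 < u ^ (2 * alphac p - 1) := rpow_pos_of_pos hu0 _
    rw [abs_mul, abs_of_pos (mul_pos (by linarith) hv)]
    have h3 : 2 * alphac p * u ^ (2 * alphac p - 1) *
        |fderiv ℝ (remainder p) (u, t, y) (0, 1, 0)| ≤ 2 * u ^ (2 * alphac p - 1) * C := by
      gcongr
      linarith
    nlinarith

theorem phi_expansion (p : ℝ) (hp : 3 ≤ p) (I : Set ℝ)
    (hIc : IsCompact I) (hIsub : I ⊆ Set.Ioo 0 (p ^ (1 / qc p))) :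
    ∃ C > (0:ℝ), ∃ u₀ > (0:ℝ), ∀ u ∈ Set.Ioc (0:ℝ) u₀, ∀ y ∈ I,
      |Phi p u y - (Ffun p y + u * Gfun p y)| ≤ C * u ^ (2 * alphac p) ∧
      |deriv (fun s => Phi p u s) y
          - (deriv (fun s => Ffun p s) y + u * deriv (fun s => Gfun p s) y)|
        ≤ C * u ^ (2 * alphac p) ∧
      |deriv (fun s => Phi p s y) u - Gfun p y| ≤ C * u ^ (2 * alphac p - 1) := by
  refine hIc.induction_on (p := fun J =>
    ∃ C > (0:ℝ), ∃ u₀ > (0:ℝ), ∀ u ∈ Set.Ioc (0:ℝ) u₀, ∀ y ∈ J,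
      |Phi p u y - (Ffun p y + u * Gfun p y)| ≤ C * u ^ (2 * alphac p) ∧
      |deriv (fun s => Phi p u s) y
          - (deriv (fun s => Ffun p s) y + u * deriv (fun s => Gfun p s) y)|
        ≤ C * u ^ (2 * alphac p) ∧
      |deriv (fun s => Phi p s y) u - Gfun p y| ≤ C * u ^ (2 * alphac p - 1)) ?_ ?_ ?_ ?_
  · exact ⟨1, one_pos, 1, one_pos, by simp⟩
  · rintro J K hJK ⟨C, hC, u₀, hu₀, h⟩
    exact ⟨C, hC, u₀, hu₀, fun u hu y hy => h u hu y (hJK hy)⟩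
  · rintro J K ⟨C₁, hC₁, u₁, hu₁, h₁⟩ ⟨C₂, hC₂, u₂, hu₂, h₂⟩
    refine ⟨C₁ + C₂, by positivity, min u₁ u₂, lt_min hu₁ hu₂, fun u hu y hy => ?_⟩
    have hκ : 0 < u ^ (2 * alphac p) := rpow_pos_of_pos hu.1 _
    have hκ₁ : 0 < u ^ (2 * alphac p - 1) := rpow_pos_of_pos hu.1 _
    rcases hy with hy | hy
    · obtain ⟨ha, hb, hc⟩ := h₁ u ⟨hu.1, hu.2.trans (min_le_left _ _)⟩ y hy
      refine ⟨ha.trans ?_, hb.trans ?_, hc.trans ?_⟩ <;> gcongr <;> linarith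
    · obtain ⟨ha, hb, hc⟩ := h₂ u ⟨hu.1, hu.2.trans (min_le_right _ _)⟩ y hy
      refine ⟨ha.trans ?_, hb.trans ?_, hc.trans ?_⟩ <;> gcongr <;> linarith
  · intro y₀ hy₀
    obtain ⟨C, hC, r, hr, h⟩ := exists_local_bounds hp (hIsub hy₀).1 (hIsub hy₀).2
    exact ⟨Metric.ball y₀ r, mem_nhdsWithin_of_mem_nhds (Metric.ball_mem_nhds y₀ hr), C, hC, r / 2,
      half_pos hr, fun u hu y hy => h u ⟨hu.1, hu.2.trans_lt (half_lt_self hr)⟩ y hy⟩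

end Stmt4
end
end

section
/- Fix p ≥ 3 and let Φ(u,y) be the scaled one-step Frank–Wolfe map. There exist u₀ > 0 and a function y* : [0, u₀] → (0, ∞), continuous on [0, u₀], continuously differentiable on (0, u₀], and Lipschitz on [0, u₀], with y*(0) = C_p, such that Φ(u, y*(u)) = y*(u) for all u ∈ (0, u₀]. Moreover, as u ↓ 0, y*(u) = C_p + D_p·u + O(u^κ), where C_p = (p/(p+1))^{1/q} and D_p = C_p·(p-1)(3p+1)/(2p(p+1)²); and z*(u) := y*(u)^q satisfies z*(u) = p/(p+1) + (p(3p+1)/(2(p+1)³))·u + o(u). -/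
/-!
STATEMENT 5: Existence and first-order expansion of the fixed-point curve y*(u)
of the scaled one-step Frank–Wolfe map Φ(u,·), with y*(0) = C_p,
y*(u) = C_p + D_p·u + O(u^κ), and z*(u) = y*(u)^q = p/(p+1) + (p(3p+1)/(2(p+1)³))·u + o(u).
-/

noncomputable section
open Real

namespace Stmt5

/-- Hölder conjugate q = p/(p-1). -/
def qc (p : ℝ) : ℝ := p / (p - 1)

/-- α = (p-1)/p = 1/q. -/
def alphac (p : ℝ) : ℝ := (p - 1) / p

/-- M = (u^q + |w|^q)^{1/q}. -/
def Mv (p u w : ℝ) : ℝ := (u ^ qc p + |w| ^ qc p) ^ (1 / qc p)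

/-- First coordinate of the LMO output: v₁ = u^{q-1}/M^{q-1}. -/
def v1f (p u w : ℝ) : ℝ := u ^ (qc p - 1) / Mv p u w ^ (qc p - 1)

/-- Second coordinate of the LMO output: v₂ = -sign(w)·|w|^{q-1}/M^{q-1}. -/
def v2f (p u w : ℝ) : ℝ := -(Real.sign w) * |w| ^ (qc p - 1) / Mv p u w ^ (qc p - 1)

/-- d₁ = v₁ - 1 + u. -/
def d1f (p u w : ℝ) : ℝ := v1f p u w - 1 + u

/-- d₂ = v₂ - w. -/
def d2f (p u w : ℝ) : ℝ := v2f p u w - w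

/-- Exact line-search step size γ = (M - u + u² + w²)/(d₁² + d₂²). -/
def gamf (p u w : ℝ) : ℝ :=
  (Mv p u w - u + u ^ 2 + w ^ 2) / (d1f p u w ^ 2 + d2f p u w ^ 2)

/-- u' = u - γ·d₁. -/
def uN (p u w : ℝ) : ℝ := u - gamf p u w * d1f p u w

/-- w' = w + γ·d₂. -/
def wN (p u w : ℝ) : ℝ := w + gamf p u w * d2f p u w

/-- Scaled one-step map Φ(u,y) = |w'|/(u')^{1+α} where w = y·u^{1+α}. -/
def Phi (p u y : ℝ) : ℝ :=
  |wN p u (y * u ^ (1 + alphac p))| /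
    (uN p u (y * u ^ (1 + alphac p))) ^ (1 + alphac p)

/-- C_p = (p/(p+1))^{1/q}. -/
def Cp (p : ℝ) : ℝ := (p / (p + 1)) ^ (1 / qc p)

/-- D_p = C_p·(p-1)(3p+1)/(2p(p+1)²). -/
def Dp (p : ℝ) : ℝ := Cp p * ((p - 1) * (3 * p + 1)) / (2 * p * (p + 1) ^ 2)

open Filter Topology

theorem exists_norm_sub_fderiv_le {E : Type*} [NormedAddCommGroup E] [NormedSpace ℝ E]
    {f : E → ℝ} {x : E} (hf : ContDiffAt ℝ 2 f x) :
    ∃ K : ℝ, 0 ≤ K ∧ ∀ᶠ v in 𝓝 x, ‖f v - f x - fderiv ℝ f x (v - x)‖ ≤ K * ‖v - x‖ ^ 2 := by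
  have h1 : ContDiffAt ℝ 1 (fderiv ℝ f) x := hf.fderiv_right (by norm_num)
  obtain ⟨K, s, hs, hK⟩ := h1.exists_lipschitzOnWith
  have hd : ∀ᶠ v in 𝓝 x, DifferentiableAt ℝ f v :=
    (hf.eventually (by simp)).mono fun v hv => hv.differentiableAt (by simp)
  obtain ⟨ε, hε, hball⟩ := Metric.eventually_nhds_iff_ball.1 (hd.and hs)
  refine ⟨K, K.2, Metric.eventually_nhds_iff_ball.2 ⟨ε, hε, fun v hv => ?_⟩⟩
  have hsub : Metric.closedBall x ‖v - x‖ ⊆ Metric.ball x ε := by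
    apply Metric.closedBall_subset_ball
    simpa [dist_eq_norm] using hv
  have key := (convex_closedBall x ‖v - x‖).norm_image_sub_le_of_norm_hasFDerivWithin_le'
    (f := f) (f' := fderiv ℝ f) (φ := fderiv ℝ f x) (C := K * ‖v - x‖) (x := x) (y := v)
    (fun w hw => (hball w (hsub hw)).1.hasFDerivAt.hasFDerivWithinAt)
    (fun w hw => by
      refine (hK.norm_sub_le (hball w (hsub hw)).2 (mem_of_mem_nhds hs)).trans ?_
      gcongr
      simpa [dist_eq_norm] using hw)
    (by simp) (by simp [dist_eq_norm])
  rw [pow_two, ← mul_assoc]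
  exact key

theorem exists_implicit_rpow_curve {F : (ℝ × ℝ) × ℝ → ℝ} {C a b κ : ℝ}
    (hF : ContDiffAt ℝ 2 F ((0, 0), C)) (h0 : F ((0, 0), C) = 0)
    (ha : HasDerivAt (fun s => F ((s, 0), C)) a 0)
    (hb : HasDerivAt (fun y => F ((0, 0), y)) b C) (hb0 : b ≠ 0)
    (hκ : 1 < κ) (hκ2 : κ ≤ 2) :
    ∃ y : ℝ → ℝ, y 0 = C ∧ ContDiffAt ℝ 1 y 0 ∧ HasDerivAt y (-a / b) 0 ∧
      (∀ᶠ u in 𝓝 0, F ((u, u ^ κ), y u) = 0) ∧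
      ∃ K > 0, ∀ᶠ u in 𝓝[>] 0, |y u - (C + -a / b * u)| ≤ K * u ^ κ := by
  have hF' := (hF.hasStrictFDerivAt (by simp)).hasFDerivAt
  set F' := fderiv ℝ F ((0, 0), C)
  have haF : F' ((1, 0), 0) = a := by
    have h : HasDerivAt (fun s : ℝ => (((s, 0), C) : (ℝ × ℝ) × ℝ)) ((1, 0), 0) 0 :=
      ((hasDerivAt_id _).prodMk (hasDerivAt_const _ _)).prodMk (hasDerivAt_const _ _)
    exact (HasFDerivAt.comp_hasDerivAt (0 : ℝ) hF' h).unique ha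
  have hbF : F' ((0, 0), 1) = b := by
    have h : HasDerivAt (fun y : ℝ => (((0, 0), y) : (ℝ × ℝ) × ℝ)) ((0, 0), 1) C :=
      (hasDerivAt_const _ _).prodMk (hasDerivAt_id _)
    exact (HasFDerivAt.comp_hasDerivAt C hF' h).unique hb
  have hinv : (F' ∘L .inr ℝ (ℝ × ℝ) ℝ).IsInvertible := by
    refine ⟨ContinuousLinearEquiv.unitsEquivAut ℝ (Units.mk0 b hb0), ?_⟩
    ext
    simpa using! hbF.symm
  set Y := hF.implicitFunction (by simp) hinv
  have hY : ContDiffAt ℝ 2 Y (0, 0) := hF.contDiffAt_implicitFunction (by simp) hinv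
  have hY0 : Y (0, 0) = C := hF.implicitFunction_apply_self (by simp) hinv
  have hYF : ∀ᶠ v in 𝓝 ((0 : ℝ), (0 : ℝ)), F (v, Y v) = 0 := by
    have := hF.eventually_apply_implicitFunction (by simp) hinv
    rwa [h0] at this
  have hzero : (0 : ℝ) ^ κ = 0 := zero_rpow (by linarith)
  have hcurve : ContDiff ℝ 1 fun u : ℝ => (u, u ^ κ) :=
    contDiff_id.prodMk (contDiff_rpow_const_of_le (n := 1) (by exact_mod_cast hκ.le))
  have hcurve0 : Tendsto (fun u : ℝ => (u, u ^ κ)) (𝓝 0) (𝓝 (0, 0)) := by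
    have := hcurve.continuous.tendsto 0
    rwa [hzero] at this
  have hcurve' : HasDerivAt (fun u : ℝ => (u, u ^ κ)) (1, 0) 0 := by
    have h := hasDerivAt_rpow_const (x := 0) (p := κ) (Or.inr hκ.le)
    rw [zero_rpow (by linarith : κ - 1 ≠ 0), mul_zero] at h
    exact (hasDerivAt_id _).prodMk h
  have hyC : ContDiffAt ℝ 1 (fun u : ℝ => Y (u, u ^ κ)) 0 := by
    refine ContDiffAt.comp (0 : ℝ) ?_ hcurve.contDiffAt
    rw [hzero]
    exact hY.of_le (by norm_num)
  have hYd : HasFDerivAt Y (fderiv ℝ Y (0, 0)) (0, 0) :=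
    (hY.differentiableAt (by simp)).hasFDerivAt
  have hyd : HasDerivAt (fun u : ℝ => Y (u, u ^ κ)) (fderiv ℝ Y (0, 0) (1, 0)) 0 := by
    refine HasFDerivAt.comp_hasDerivAt (0 : ℝ) ?_ hcurve'
    rw [hzero]; exact hYd
  have heq : ∀ᶠ u in 𝓝 (0 : ℝ), F ((u, u ^ κ), Y (u, u ^ κ)) = 0 := hcurve0.eventually hYF
  have hd : fderiv ℝ Y (0, 0) (1, 0) = -a / b := by
    set d := fderiv ℝ Y (0, 0) (1, 0)
    have h1 : HasDerivAt (fun u : ℝ => F ((u, u ^ κ), Y (u, u ^ κ))) (F' ((1, 0), d)) 0 := by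
      refine HasFDerivAt.comp_hasDerivAt (0 : ℝ) ?_ (hcurve'.prodMk hyd)
      rw [hzero, hY0]; exact hF'
    have h2 : F' ((1, 0), d) = 0 :=
      h1.unique ((hasDerivAt_const (0 : ℝ) (0 : ℝ)).congr_of_eventuallyEq heq)
    have h3 : (((1, 0), d) : (ℝ × ℝ) × ℝ) = ((1, 0), 0) + d • ((0, 0), 1) := by
      ext <;> simp
    rw [h3, map_add, map_smul, haF, hbF, smul_eq_mul] at h2
    rw [eq_div_iff hb0]; linarith
  refine ⟨fun u => Y (u, u ^ κ), by simp only [hzero, hY0], hyC, hd ▸ hyd, heq, ?_⟩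
  obtain ⟨K, hK0, hK⟩ := exists_norm_sub_fderiv_le hY
  refine ⟨K + |fderiv ℝ Y (0, 0) (0, 1)| + 1, by positivity, ?_⟩
  filter_upwards [nhdsWithin_le_nhds (hcurve0.eventually hK), self_mem_nhdsWithin,
    nhdsWithin_le_nhds (Iio_mem_nhds one_pos)] with u hu hu0 hu1
  have hu0 : 0 < u := hu0
  have hu1 : u < 1 := hu1
  have hpos : 0 < u ^ κ := rpow_pos_of_pos hu0 κ
  have hle : u ^ κ ≤ u := by
    simpa using rpow_le_rpow_of_exponent_ge hu0 hu1.le hκ.le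
  have hsq : u ^ 2 ≤ u ^ κ := by
    simpa using rpow_le_rpow_of_exponent_ge hu0 hu1.le hκ2
  have hnorm : ‖((u, u ^ κ) : ℝ × ℝ) - (0, 0)‖ = u := by
    simp [Prod.norm_def, abs_of_pos hu0, abs_of_pos hpos, hle]
  have hsplit : ((u, u ^ κ) : ℝ × ℝ) - (0, 0) = u • (1, 0) + u ^ κ • (0, 1) := by
    ext <;> simp
  rw [hnorm, hsplit, map_add, map_smul, map_smul, hd, hY0, smul_eq_mul, smul_eq_mul,
    Real.norm_eq_abs] at hu
  set e := fderiv ℝ Y (0, 0) (0, 1)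
  calc |Y (u, u ^ κ) - (C + -a / b * u)|
      = |(Y (u, u ^ κ) - C - (u * (-a / b) + u ^ κ * e)) + u ^ κ * e| := by ring_nf
    _ ≤ K * u ^ 2 + |u ^ κ * e| := (abs_add_le _ _).trans (by gcongr)
    _ ≤ K * u ^ κ + u ^ κ * |e| := by rw [abs_mul, abs_of_pos hpos]; gcongr
    _ ≤ (K + |e| + 1) * u ^ κ := by nlinarith

/-- The difference quotient `((1 + s)^r - 1) / s`, extended by its limit at `s = 0`. -/
def rpowSlope (r : ℝ) : ℝ → ℝ := dslope (fun s => (1 + s) ^ r) 0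

theorem mul_rpowSlope (r s : ℝ) : s * rpowSlope r s = (1 + s) ^ r - 1 := by
  simpa using! sub_smul_dslope (fun s : ℝ => (1 + s) ^ r) 0 s

theorem contDiffAt_one_add_rpow (r : ℝ) {n : WithTop ℕ∞} :
    ContDiffAt ℝ n (fun s : ℝ => (1 + s) ^ r) 0 :=
  (contDiffAt_const.add contDiffAt_id).rpow_const_of_ne (by simp)

theorem contDiffAt_rpowSlope (r : ℝ) {n : WithTop ℕ∞} : ContDiffAt ℝ n (rpowSlope r) 0 := by
  obtain ⟨_, hP⟩ := (contDiffAt_one_add_rpow r (n := ⊤)).analyticAt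
  exact AnalyticAt.contDiffAt ⟨_, hP.has_fpower_series_dslope_fslope⟩

theorem hasDerivAt_one_add_rpow (r : ℝ) {s : ℝ} (hs : 1 + s ≠ 0) :
    HasDerivAt (fun s : ℝ => (1 + s) ^ r) (r * (1 + s) ^ (r - 1)) s := by
  simpa using ((hasDerivAt_id s).const_add 1).rpow_const (p := r) (Or.inl hs)

theorem rpowSlope_zero (r : ℝ) : rpowSlope r 0 = r := by
  rw [rpowSlope, dslope_same]
  simpa using (hasDerivAt_one_add_rpow r (s := 0) (by simp)).deriv

theorem hasDerivAt_rpowSlope_zero (r : ℝ) :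
    HasDerivAt (rpowSlope r) (r * (r - 1) / 2) 0 := by
  have hC := contDiffAt_rpowSlope r (n := 2)
  have hd := (hC.differentiableAt (by simp)).hasDerivAt
  have hdd : DifferentiableAt ℝ (deriv (rpowSlope r)) 0 :=
    ((hC.fderiv_right (m := 1) (by norm_num)).clm_apply contDiffAt_const).differentiableAt
      (by simp)
  have heq : (fun s => rpowSlope r s + s * deriv (rpowSlope r) s) =ᶠ[𝓝 0]
      fun s => r * (1 + s) ^ (r - 1) := by
    filter_upwards [hC.eventually (by simp), lt_mem_nhds (neg_one_lt_zero (R := ℝ))] with s hs hs1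
    have h1 : HasDerivAt (fun s => 1 + s * rpowSlope r s) _ s :=
      ((hasDerivAt_id s).mul (hs.differentiableAt (by simp)).hasDerivAt).const_add 1
    have h2 := hasDerivAt_one_add_rpow r (s := s) (by linarith)
    simp only [mul_rpowSlope, add_sub_cancel, id, one_mul] at h1
    exact h1.unique h2
  have h1 : HasDerivAt (fun s => rpowSlope r s + s * deriv (rpowSlope r) s) _ 0 :=
    hd.add ((hasDerivAt_id (0 : ℝ)).mul hdd.hasDerivAt)
  have h2 := (hasDerivAt_one_add_rpow (r - 1) (s := 0) (by simp)).const_mul r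
  have h3 := (h1.congr_of_eventuallyEq heq.symm).unique h2
  simp only [id, one_mul, zero_mul, add_zero, one_rpow, mul_one] at h3
  have h4 : r * (r - 1) / 2 = deriv (rpowSlope r) 0 := by linarith
  exact h4 ▸ hd

/-- `d₁ / u` in terms of `u` and `z = y ^ q`. -/
def scaledD1 (p : ℝ) (x : (ℝ × ℝ) × ℝ) : ℝ :=
  1 + x.2 ^ qc p * rpowSlope (-(1 / p)) (x.2 ^ qc p * x.1.1)

/-- The numerator of the step size divided by `u²`, as a function of `((u, t), y)`, `t = u ^ κ`. -/
def scaledNum (p : ℝ) (x : (ℝ × ℝ) × ℝ) : ℝ :=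
  1 + x.2 ^ qc p * rpowSlope (alphac p) (x.2 ^ qc p * x.1.1) + x.2 ^ 2 * x.1.2

/-- `-d₂ / u ^ (1 / p)` as a function of `((u, t), y)`, `t = u ^ κ`. -/
def scaledD2 (p : ℝ) (x : (ℝ × ℝ) × ℝ) : ℝ :=
  x.2 ^ (qc p - 1) * (1 + x.2 ^ qc p * x.1.1) ^ (-(1 / p)) + x.2 * x.1.2

/-- The step size divided by `t = u ^ κ`, as a function of `((u, t), y)`. -/
def scaledStep (p : ℝ) (x : (ℝ × ℝ) × ℝ) : ℝ :=
  scaledNum p x / (scaledD2 p x ^ 2 + x.1.2 * scaledD1 p x ^ 2)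

/-- The contraction ratio `u' / u` as a function of `((u, t), y)`, `t = u ^ κ`. -/
def scaledRatio (p : ℝ) (x : (ℝ × ℝ) × ℝ) : ℝ :=
  1 - x.1.2 * scaledD1 p x * scaledStep p x

/-- A function of `((u, t), y)` whose zeros with `t = u ^ κ` are the fixed points of `Φ(u, ·)`. -/
def fixedPointEq (p : ℝ) (x : (ℝ × ℝ) × ℝ) : ℝ :=
  scaledD2 p x * scaledStep p x - x.2 - x.2 * scaledRatio p x ^ (1 + alphac p)

section

variable {p : ℝ}

theorem Mv_scaled (hp : 1 < p) {u y : ℝ} (hu : 0 < u) (hy : 0 < y) :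
    Mv p u (y * u ^ (1 + alphac p)) = u * (1 + y ^ qc p * u) ^ alphac p := by
  have hp1 : p - 1 ≠ 0 := by linarith
  have hp0 : p ≠ 0 := by linarith
  have hq : 1 / qc p = alphac p := by rw [qc, alphac]; field_simp
  have hq1 : qc p * alphac p = 1 := by rw [qc, alphac]; field_simp
  have hqs : (1 + alphac p) * qc p = qc p + 1 := by linarith
  have hz : 0 < y ^ qc p := by positivity
  rw [Mv, abs_of_pos (by positivity), mul_rpow hy.le (by positivity), ← rpow_mul hu.le, hqs,
    rpow_add hu, rpow_one, hq,
    show u ^ qc p + y ^ qc p * (u ^ qc p * u) = u ^ qc p * (1 + y ^ qc p * u) by ring,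
    mul_rpow (by positivity) (by positivity), ← rpow_mul hu.le, hq1, rpow_one]

theorem Mv_scaled_rpow (hp : 1 < p) {u y : ℝ} (hu : 0 < u) (hy : 0 < y) :
    Mv p u (y * u ^ (1 + alphac p)) ^ (qc p - 1) =
      u ^ (qc p - 1) * (1 + y ^ qc p * u) ^ (1 / p) := by
  have hp1 : p - 1 ≠ 0 := by linarith
  have hp0 : p ≠ 0 := by linarith
  have hq : alphac p * (qc p - 1) = 1 / p := by rw [qc, alphac]; field_simp; ring
  have hz : 0 < y ^ qc p := by positivity
  rw [Mv_scaled hp hu hy, mul_rpow hu.le (by positivity), ← rpow_mul (by positivity), hq]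

theorem d1f_scaled (hp : 1 < p) {u y : ℝ} (hu : 0 < u) (hy : 0 < y) (t : ℝ) :
    d1f p u (y * u ^ (1 + alphac p)) = u * scaledD1 p ((u, t), y) := by
  have hz : 0 < y ^ qc p := by positivity
  have hv : v1f p u (y * u ^ (1 + alphac p)) = (1 + y ^ qc p * u) ^ (-(1 / p)) := by
    rw [v1f, Mv_scaled_rpow hp hu hy, rpow_neg (by positivity)]
    field_simp
  have := mul_rpowSlope (-(1 / p)) (y ^ qc p * u)
  rw [d1f, hv, scaledD1]
  linear_combination -this

theorem d2f_scaled (hp : 1 < p) {u y : ℝ} (hu : 0 < u) (hy : 0 < y) :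
    d2f p u (y * u ^ (1 + alphac p)) =
      -(u ^ (1 / p) * scaledD2 p ((u, u ^ (2 * alphac p)), y)) := by
  have hp1 : p - 1 ≠ 0 := by linarith
  have hp0 : p ≠ 0 := by linarith
  have hz : 0 < y ^ qc p := by positivity
  have hw : 0 < y * u ^ (1 + alphac p) := by positivity
  have he : (1 + alphac p) * (qc p - 1) = qc p - 1 + 1 / p := by rw [qc, alphac]; field_simp; ring
  have he' : u ^ (1 + alphac p) = u ^ (1 / p) * u ^ (2 * alphac p) := by
    rw [← rpow_add hu]; congr 1; rw [alphac]; field_simp; ring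
  have hv : v2f p u (y * u ^ (1 + alphac p)) =
      -(u ^ (1 / p) * (y ^ (qc p - 1) * (1 + y ^ qc p * u) ^ (-(1 / p)))) := by
    rw [v2f, Mv_scaled_rpow hp hu hy, Real.sign_of_pos hw, abs_of_pos hw,
      mul_rpow hy.le (by positivity), ← rpow_mul hu.le, he, rpow_add hu,
      rpow_neg (by positivity) (1 / p)]
    field_simp
  rw [d2f, hv, scaledD2]
  simp only
  rw [he']
  ring

theorem gamf_scaled (hp : 1 < p) {u y : ℝ} (hu : 0 < u) (hy : 0 < y) :
    gamf p u (y * u ^ (1 + alphac p)) =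
      u ^ (2 * alphac p) * scaledStep p ((u, u ^ (2 * alphac p)), y) := by
  have hp0 : p ≠ 0 := by linarith
  have hM := Mv_scaled hp hu hy
  have hs := mul_rpowSlope (alphac p) (y ^ qc p * u)
  have hsq : (u ^ (1 + alphac p)) ^ 2 = u ^ 2 * u ^ (2 * alphac p) := by
    rw [← rpow_natCast u 2, ← rpow_add hu, ← rpow_natCast, ← rpow_mul hu.le]
    congr 1; push_cast; ring
  have hinv : u ^ 2 = u ^ (2 * alphac p) * (u ^ (1 / p)) ^ 2 := by
    rw [← rpow_natCast _ 2, ← rpow_natCast _ 2, ← rpow_mul hu.le, ← rpow_add hu]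
    congr 1; rw [alphac]; push_cast; field_simp; ring
  have hnum : Mv p u (y * u ^ (1 + alphac p)) - u + u ^ 2 + (y * u ^ (1 + alphac p)) ^ 2 =
      u ^ 2 * scaledNum p ((u, u ^ (2 * alphac p)), y) := by
    rw [hM, mul_pow, hsq, scaledNum]
    linear_combination -u * hs
  have hv : 0 < u ^ (1 / p) := by positivity
  have hden : ∀ A B t v : ℝ, (t * v ^ 2) * A ^ 2 + (-(v * B)) ^ 2 = v ^ 2 * (B ^ 2 + t * A ^ 2) := by
    intros; ring
  rw [gamf, hnum, d1f_scaled hp hu hy (u ^ (2 * alphac p)), d2f_scaled hp hu hy, scaledStep,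
    mul_pow, hinv, hden, mul_comm (u ^ (2 * alphac p)), mul_assoc,
    mul_div_mul_left _ _ (by positivity), mul_div_assoc]

theorem Phi_eq_self_of_fixedPointEq (hp : 1 < p) {u y : ℝ} (hu : 0 < u) (hy : 0 < y)
    (hR : 0 < scaledRatio p ((u, u ^ (2 * alphac p)), y))
    (h : fixedPointEq p ((u, u ^ (2 * alphac p)), y) = 0) : Phi p u y = y := by
  have hp0 : p ≠ 0 := by linarith
  set t := u ^ (2 * alphac p) with ht
  have he : u ^ (1 + alphac p) = t * u ^ (1 / p) := by
    rw [ht, ← rpow_add hu]; congr 1; rw [alphac]; field_simp; ring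
  have hu' : uN p u (y * u ^ (1 + alphac p)) = u * scaledRatio p ((u, t), y) := by
    rw [uN, gamf_scaled hp hu hy, d1f_scaled hp hu hy t, scaledRatio]
    ring
  have hw' : wN p u (y * u ^ (1 + alphac p)) =
      -(u ^ (1 + alphac p) * (y * scaledRatio p ((u, t), y) ^ (1 + alphac p))) := by
    rw [fixedPointEq] at h
    rw [wN, gamf_scaled hp hu hy, d2f_scaled hp hu hy, ← ht]
    simp only at h
    rw [he]
    linear_combination -(t * u ^ (1 / p)) * h
  rw [Phi, hu', hw', abs_neg, abs_of_pos (by positivity), mul_rpow hu.le hR.le]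
  field_simp

theorem Cp_pos (hp : 1 < p) : 0 < Cp p := by
  have : 0 < p := by linarith
  rw [Cp]; positivity

theorem Cp_rpow_qc (hp : 1 < p) : Cp p ^ qc p = p / (p + 1) := by
  have hp0 : 0 < p := by linarith
  have hp1 : 0 < p - 1 := by linarith
  rw [Cp, one_div, rpow_inv_rpow (by positivity) (by rw [qc]; positivity)]

theorem Cp_rpow_qc_sub_one (hp : 1 < p) : Cp p ^ (qc p - 1) = p / (p + 1) / Cp p := by
  rw [rpow_sub_one (Cp_pos hp).ne', Cp_rpow_qc hp]

theorem contDiffAt_scaledStep {C : ℝ} (hC : 0 < C) {n : WithTop ℕ∞} :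
    ContDiffAt ℝ n (scaledD1 p) ((0, 0), C) ∧ ContDiffAt ℝ n (scaledD2 p) ((0, 0), C) ∧
      ContDiffAt ℝ n (scaledStep p) ((0, 0), C) := by
  have hy : ContDiffAt ℝ n (fun x : (ℝ × ℝ) × ℝ => x.2) ((0, 0), C) := contDiffAt_snd
  have hu : ContDiffAt ℝ n (fun x : (ℝ × ℝ) × ℝ => x.1.1) ((0, 0), C) := contDiffAt_fst.fst
  have ht : ContDiffAt ℝ n (fun x : (ℝ × ℝ) × ℝ => x.1.2) ((0, 0), C) := contDiffAt_fst.snd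
  have hpow (r : ℝ) : ContDiffAt ℝ n (fun x : (ℝ × ℝ) × ℝ => x.2 ^ r) ((0, 0), C) :=
    hy.rpow_const_of_ne hC.ne'
  have hzu := (hpow (qc p)).mul hu
  have hslope (r : ℝ) : ContDiffAt ℝ n
      (fun x : (ℝ × ℝ) × ℝ => rpowSlope r (x.2 ^ qc p * x.1.1)) ((0, 0), C) :=
    ContDiffAt.comp (g := rpowSlope r) _ (by simpa using contDiffAt_rpowSlope r) hzu
  have h1 : ContDiffAt ℝ n (scaledD1 p) ((0, 0), C) :=
    contDiffAt_const.add ((hpow _).mul (hslope _))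
  have h2 : ContDiffAt ℝ n (scaledD2 p) ((0, 0), C) :=
    ((hpow _).mul ((contDiffAt_const.add hzu).rpow_const_of_ne (by simp))).add (hy.mul ht)
  have hN : ContDiffAt ℝ n (scaledNum p) ((0, 0), C) :=
    (contDiffAt_const.add ((hpow _).mul (hslope _))).add ((hy.pow 2).mul ht)
  refine ⟨h1, h2, hN.div ((h2.pow 2).add (ht.mul (h1.pow 2))) ?_⟩
  simp [scaledD2, (rpow_pos_of_pos hC (qc p - 1)).ne']

theorem contDiffAt_scaledRatio {C : ℝ} (hC : 0 < C) {n : WithTop ℕ∞} :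
    ContDiffAt ℝ n (scaledRatio p) ((0, 0), C) :=
  contDiffAt_const.sub ((contDiffAt_fst.snd.mul (contDiffAt_scaledStep hC).1).mul
    (contDiffAt_scaledStep hC).2.2)

theorem contDiffAt_fixedPointEq {C : ℝ} (hC : 0 < C) {n : WithTop ℕ∞} :
    ContDiffAt ℝ n (fixedPointEq p) ((0, 0), C) :=
  (((contDiffAt_scaledStep hC).2.1.mul (contDiffAt_scaledStep hC).2.2).sub contDiffAt_snd).sub
    (contDiffAt_snd.mul ((contDiffAt_scaledRatio hC).rpow_const_of_ne (by simp [scaledRatio])))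

theorem fixedPointEq_of_snd_eq_zero {u y : ℝ} (hy : 0 < y) (hu : 0 < 1 + y ^ qc p * u) :
    fixedPointEq p ((u, 0), y) =
      (1 + y ^ qc p * rpowSlope (alphac p) (y ^ qc p * u)) * (1 + y ^ qc p * u) ^ (1 / p) *
        (y ^ (qc p - 1))⁻¹ - 2 * y := by
  have h1 : 0 < y ^ (qc p - 1) := by positivity
  have h2 : 0 < (1 + y ^ qc p * u) ^ (1 / p) := by positivity
  simp only [fixedPointEq, scaledStep, scaledRatio, scaledNum, scaledD2, mul_zero, zero_mul,
    add_zero, sub_zero, one_rpow, rpow_neg hu.le]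
  field_simp
  ring

theorem fixedPointEq_Cp (hp : 1 < p) : fixedPointEq p ((0, 0), Cp p) = 0 := by
  have hC := Cp_pos hp
  have hp1 : 0 < p + 1 := by linarith
  have hp0 : 0 < p := by linarith
  rw [fixedPointEq_of_snd_eq_zero hC (by simp), mul_zero, rpowSlope_zero, Cp_rpow_qc hp,
    Cp_rpow_qc_sub_one hp, add_zero, one_rpow, alphac]
  field_simp
  ring

theorem hasDerivAt_fixedPointEq_fst (hp : 1 < p) :
    HasDerivAt (fun s => fixedPointEq p ((s, 0), Cp p))
      (Cp p * (3 * p + 1) / (2 * p * (p + 1))) 0 := by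
  have hC := Cp_pos hp
  have hp1 : 0 < p + 1 := by linarith
  have hp0 : 0 < p := by linarith
  set z := Cp p ^ qc p with hz
  have hlin : HasDerivAt (fun s => z * s) z 0 := by
    simpa using (hasDerivAt_id (0 : ℝ)).const_mul z
  have h1 : HasDerivAt (fun s => rpowSlope (alphac p) (z * s)) _ 0 :=
    HasDerivAt.comp (h₂ := rpowSlope (alphac p)) (0 : ℝ)
      (by simpa using hasDerivAt_rpowSlope_zero (alphac p)) hlin
  have h2 : HasDerivAt (fun s => (1 + z * s) ^ (1 / p)) _ 0 :=
    HasDerivAt.comp (h₂ := fun s => (1 + s) ^ (1 / p)) (0 : ℝ)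
      (hasDerivAt_one_add_rpow (1 / p) (s := z * 0) (by simp)) hlin
  have h3 := ((((h1.const_mul z).const_add 1).mul h2).mul_const
    (Cp p ^ (qc p - 1))⁻¹).sub_const (2 * Cp p)
  have hev : ∀ᶠ s in 𝓝 (0 : ℝ), 0 < 1 + z * s := by
    have : ContinuousAt (fun s : ℝ => 1 + z * s) 0 := by fun_prop
    exact this.eventually (lt_mem_nhds (by simp))
  refine (h3.congr_of_eventuallyEq (hev.mono fun s hs =>
    fixedPointEq_of_snd_eq_zero hC hs)).congr_deriv ?_
  simp only [mul_zero, rpowSlope_zero, add_zero, one_rpow]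
  rw [Cp_rpow_qc_sub_one hp, hz, Cp_rpow_qc hp, alphac]
  field_simp
  ring

theorem hasDerivAt_fixedPointEq_snd (hp : 1 < p) :
    HasDerivAt (fun y => fixedPointEq p ((0, 0), y)) (-(p + 1) / (p - 1)) (Cp p) := by
  have hC := Cp_pos hp
  have hp1 : 0 < p + 1 := by linarith
  have hp0 : 0 < p := by linarith
  have hpm : 0 < p - 1 := by linarith
  have h1 := ((hasDerivAt_rpow_const (x := Cp p) (p := 1 - qc p) (Or.inl hC.ne')).add
    ((hasDerivAt_id (Cp p)).const_mul (alphac p))).sub ((hasDerivAt_id (Cp p)).const_mul 2)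
  have hev : (fun y => fixedPointEq p ((0, 0), y)) =ᶠ[𝓝 (Cp p)]
      fun y => y ^ (1 - qc p) + alphac p * y - 2 * y := by
    filter_upwards [lt_mem_nhds hC] with y hy
    rw [fixedPointEq_of_snd_eq_zero hy (by simp), mul_zero, rpowSlope_zero, add_zero, one_rpow,
      rpow_sub hy, rpow_sub hy, rpow_one]
    field_simp
  refine (h1.congr_of_eventuallyEq hev).congr_deriv ?_
  rw [show 1 - qc p - 1 = -qc p by ring, rpow_neg hC.le, Cp_rpow_qc hp, qc, alphac]
  field_simp
  ring

end

theorem fixed_point_curve (p : ℝ) (hp : 3 ≤ p) :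
    ∃ u₀ > (0:ℝ), ∃ ystar : ℝ → ℝ,
      -- continuous on [0, u₀]
      ContinuousOn ystar (Set.Icc 0 u₀) ∧
      -- C¹ on (0, u₀]
      (∀ u ∈ Set.Ioc (0:ℝ) u₀, DifferentiableAt ℝ ystar u) ∧
      ContinuousOn (deriv ystar) (Set.Ioc 0 u₀) ∧
      -- Lipschitz on [0, u₀]
      (∃ L : NNReal, LipschitzOnWith L ystar (Set.Icc 0 u₀)) ∧
      -- maps into (0, ∞) with y*(0) = C_p
      ystar 0 = Cp p ∧
      (∀ u ∈ Set.Icc (0:ℝ) u₀, 0 < ystar u) ∧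
      -- fixed point property
      (∀ u ∈ Set.Ioc (0:ℝ) u₀, Phi p u (ystar u) = ystar u) ∧
      -- y*(u) = C_p + D_p·u + O(u^κ) as u ↓ 0
      (∃ C > (0:ℝ), ∀ u ∈ Set.Ioc (0:ℝ) u₀,
        |ystar u - (Cp p + Dp p * u)| ≤ C * u ^ (2 * alphac p)) ∧
      -- z*(u) = y*(u)^q = p/(p+1) + (p(3p+1)/(2(p+1)³))·u + o(u) as u ↓ 0
      Filter.Tendsto
        (fun u => ((ystar u) ^ qc p
            - (p / (p + 1) + (p * (3 * p + 1) / (2 * (p + 1) ^ 3)) * u)) / u)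
        (nhdsWithin (0:ℝ) (Set.Ioi 0)) (nhds 0) := by
  have hp1 : 1 < p := by linarith
  have hp0 : 0 < p := by linarith
  have hpm : 0 < p - 1 := by linarith
  have hC := Cp_pos hp1
  have hκ : 2 * alphac p = 2 - 2 / p := by rw [alphac]; field_simp
  have hκ1 : 2 / p < 1 := by rw [div_lt_one hp0]; linarith
  have hκ0 : 0 < 2 / p := by positivity
  have hslope : -(Cp p * (3 * p + 1) / (2 * p * (p + 1))) / (-(p + 1) / (p - 1)) = Dp p := by
    rw [Dp]; field_simp
  obtain ⟨y, hy0, hyC, hyd, hyF, K, hK0, hK⟩ := exists_implicit_rpow_curve (κ := 2 * alphac p)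
    (contDiffAt_fixedPointEq (p := p) hC) (fixedPointEq_Cp hp1) (hasDerivAt_fixedPointEq_fst hp1)
    (hasDerivAt_fixedPointEq_snd hp1) (div_neg_of_neg_of_pos (by linarith) hpm).ne
    (by linarith) (by linarith)
  rw [hslope] at hyd hK
  have hypos : ∀ᶠ u in 𝓝 (0 : ℝ), 0 < y u :=
    hyC.continuousAt.eventually (lt_mem_nhds (by rwa [hy0]))
  have hRpos : ∀ᶠ u in 𝓝 (0 : ℝ), 0 < scaledRatio p ((u, u ^ (2 * alphac p)), y u) := by
    have hz : (0 : ℝ) ^ (2 * alphac p) = 0 := zero_rpow (by linarith)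
    have hlim : Tendsto (fun u : ℝ => ((u, u ^ (2 * alphac p)), y u)) (𝓝 0)
        (𝓝 ((0, 0), Cp p)) := by
      have h1 : ContinuousAt (fun u : ℝ => u ^ (2 * alphac p)) 0 :=
        continuousAt_rpow_const _ _ (Or.inr (by linarith))
      have h2 : ContinuousAt (fun u : ℝ => ((u, u ^ (2 * alphac p)), y u)) 0 :=
        (continuousAt_id.prodMk h1).prodMk hyC.continuousAt
      simpa only [ContinuousAt, hz, hy0] using h2
    exact hlim.eventually ((contDiffAt_scaledRatio (n := 0) hC).continuousAt.eventually
      (lt_mem_nhds (by simp [scaledRatio])))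
  obtain ⟨L, s, hs, hL⟩ := hyC.exists_lipschitzOnWith
  obtain ⟨ε, hε, hball⟩ := Metric.eventually_nhds_iff_ball.1
    ((((hyC.eventually (by simp)).and hs).and (hyF.and (hypos.and hRpos))).and
      (eventually_nhdsWithin_iff.1 hK))
  have hmem : ∀ u ∈ Set.Icc (0 : ℝ) (ε / 2), u ∈ Metric.ball (0 : ℝ) ε := fun u hu => by
    rw [mem_ball_zero_iff, Real.norm_of_nonneg hu.1]; linarith [hu.2]
  have hmem' : ∀ u ∈ Set.Ioc (0 : ℝ) (ε / 2), u ∈ Metric.ball (0 : ℝ) ε := fun u hu =>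
    hmem u (Set.Ioc_subset_Icc_self hu)
  have hCD : ∀ u ∈ Metric.ball (0 : ℝ) ε, ContDiffAt ℝ 1 y u := fun u hu => (hball u hu).1.1.1
  refine ⟨ε / 2, by positivity, y, ?_, ?_, ?_, ⟨L, ?_⟩, hy0, ?_, ?_, ⟨K, hK0, ?_⟩, ?_⟩
  · exact fun u hu => (hCD u (hmem u hu)).continuousAt.continuousWithinAt
  · exact fun u hu => (hCD u (hmem' u hu)).differentiableAt (by simp)
  · exact fun u hu => (((hCD u (hmem' u hu)).fderiv_right (m := 0) (by norm_num)).clm_apply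
      contDiffAt_const).continuousAt.continuousWithinAt
  · exact hL.mono fun u hu => (hball u (hmem u hu)).1.1.2
  · exact fun u hu => (hball u (hmem u hu)).1.2.2.1
  · intro u hu
    obtain ⟨h1, h2, h3⟩ := (hball u (hmem' u hu)).1.2
    exact Phi_eq_self_of_fixedPointEq hp1 hu.1 h2 h3 h1
  · exact fun u hu => (hball u (hmem' u hu)).2 hu.1
  · have hz := hyd.rpow_const (p := qc p) (Or.inl (by rw [hy0]; exact hC.ne'))
    have hcoef : Dp p * qc p * y 0 ^ (qc p - 1) = p * (3 * p + 1) / (2 * (p + 1) ^ 3) := by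
      rw [hy0, Cp_rpow_qc_sub_one hp1, Dp, qc]; field_simp
    rw [hcoef] at hz
    have ht := ((hasDerivAt_iff_tendsto_slope_zero.1 hz).mono_left
      (nhdsWithin_mono 0 fun u (hu : 0 < u) => hu.ne')).sub_const
        (p * (3 * p + 1) / (2 * (p + 1) ^ 3))
    rw [sub_self] at ht
    refine ht.congr' ?_
    filter_upwards [self_mem_nhdsWithin] with u hu
    have hu0 : u ≠ 0 := (Set.mem_Ioi.1 hu).ne'
    rw [zero_add, hy0, Cp_rpow_qc hp1, smul_eq_mul]
    field_simp
    ring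

end Stmt5
end
end

section
/- Fix p ≥ 3, α = (p-1)/p, C_p = (p/(p+1))^{1/q} and D_p = C_p·(p-1)(3p+1)/(2p(p+1)²) with q = p/(p-1). There exists u_feas > 0 such that for all u₀ ∈ (0, u_feas], the point x₀ = (1 - u₀)·e₁ + (C_p + D_p·u₀)·u₀^{1+α}·e₂ ∈ ℝ² lies strictly inside the unit ℓ_p ball, i.e., ‖x₀‖_p < 1. -/
/-!
STATEMENT 7: Feasibility of the slow-start initialization: for all sufficiently
small u₀ > 0, x₀^slow(u₀) = (1-u₀)·e₁ + (C_p + D_p·u₀)·u₀^{1+α}·e₂ lies strictly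
inside the unit ℓ_p ball of ℝ².
-/

noncomputable section
open Real

namespace Stmt7

/-- Hölder conjugate q = p/(p-1). -/
def qc (p : ℝ) : ℝ := p / (p - 1)

/-- α = (p-1)/p. -/
def alphac (p : ℝ) : ℝ := (p - 1) / p

/-- C_p = (p/(p+1))^{1/q}. -/
def Cp (p : ℝ) : ℝ := (p / (p + 1)) ^ (1 / qc p)

/-- D_p = C_p·(p-1)(3p+1)/(2p(p+1)²). -/
def Dp (p : ℝ) : ℝ := Cp p * ((p - 1) * (3 * p + 1)) / (2 * p * (p + 1) ^ 2)

theorem slow_start_feasible (p : ℝ) (hp : 3 ≤ p) :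
    ∃ ufeas > (0:ℝ), ∀ u₀ ∈ Set.Ioc (0:ℝ) ufeas,
      (|1 - u₀| ^ p + |(Cp p + Dp p * u₀) * u₀ ^ (1 + alphac p)| ^ p) ^ (1 / p) < 1 := by
  have hp0 : 0 < p := by linarith
  have hC : 0 < Cp p := by unfold Cp; positivity
  have hD : 0 ≤ Dp p := by
    have : 0 ≤ p - 1 := by linarith
    unfold Dp; positivity
  set K := (Cp p + Dp p) ^ p with hK
  have hK0 : 0 < K := by positivity
  refine ⟨1 / (K + 2), by positivity, fun u ⟨hu0, hu⟩ => ?_⟩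
  have huK : u * (K + 2) ≤ 1 := (le_div_iff₀ (by positivity)).1 hu
  have hu1 : u ≤ 1 := by nlinarith [mul_pos hu0 hK0]
  have h_first : |1 - u| ^ p ≤ 1 - u := by
    rw [abs_of_nonneg (by linarith)]
    exact rpow_le_self_of_le_one (by linarith) (by linarith) (by linarith)
  have h_exp : (1 + alphac p) * p = 2 * p - 1 := by
    unfold alphac; field_simp; ring
  have h_second : |(Cp p + Dp p * u) * u ^ (1 + alphac p)| ^ p ≤ K * u ^ 2 := by
    rw [abs_of_nonneg (by positivity), mul_rpow (by positivity) (by positivity),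
      ← rpow_mul hu0.le, h_exp, ← rpow_two]
    gcongr ?_ * ?_
    · rw [hK]
      gcongr
      exact mul_le_of_le_one_right hD hu1
    · exact rpow_le_rpow_of_exponent_ge hu0 hu1 (by linarith)
  exact rpow_lt_one (by positivity) (by nlinarith) (by positivity)

end Stmt7
end
end

section
/- Fix p > 3 and let Φ(u,y) be the scaled one-step Frank–Wolfe map and y*(u) the fixed-point curve with y*(u) = C_p + D_p·u + O(u^κ). Then there exist u_ctr > 0, δ > 0, and λ ∈ (0,1) such that for all u ∈ (0, u_ctr] and all y with |y - y*(u)| ≤ δ, one has |∂Φ/∂y(u,y)| ≤ λ. -/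
/-!
STATEMENT 8: Local contraction of the scaled one-step map in the y-direction
for p > 3: near the fixed-point curve y*(u) one has |∂Φ/∂y(u,y)| ≤ λ < 1.
-/

noncomputable section
open Real

namespace Stmt8

/-- Hölder conjugate q = p/(p-1). -/
def qc (p : ℝ) : ℝ := p / (p - 1)

/-- α = (p-1)/p = 1/q. -/
def alphac (p : ℝ) : ℝ := (p - 1) / p

/-- M = (u^q + |w|^q)^{1/q}. -/
def Mv (p u w : ℝ) : ℝ := (u ^ qc p + |w| ^ qc p) ^ (1 / qc p)

/-- First coordinate of the LMO output: v₁ = u^{q-1}/M^{q-1}. -/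
def v1f (p u w : ℝ) : ℝ := u ^ (qc p - 1) / Mv p u w ^ (qc p - 1)

/-- Second coordinate of the LMO output: v₂ = -sign(w)·|w|^{q-1}/M^{q-1}. -/
def v2f (p u w : ℝ) : ℝ := -(Real.sign w) * |w| ^ (qc p - 1) / Mv p u w ^ (qc p - 1)

/-- d₁ = v₁ - 1 + u. -/
def d1f (p u w : ℝ) : ℝ := v1f p u w - 1 + u

/-- d₂ = v₂ - w. -/
def d2f (p u w : ℝ) : ℝ := v2f p u w - w

/-- Exact line-search step size γ = (M - u + u² + w²)/(d₁² + d₂²). -/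
def gamf (p u w : ℝ) : ℝ :=
  (Mv p u w - u + u ^ 2 + w ^ 2) / (d1f p u w ^ 2 + d2f p u w ^ 2)

/-- u' = u - γ·d₁. -/
def uN (p u w : ℝ) : ℝ := u - gamf p u w * d1f p u w

/-- w' = w + γ·d₂. -/
def wN (p u w : ℝ) : ℝ := w + gamf p u w * d2f p u w

/-- Scaled one-step map Φ(u,y) = |w'|/(u')^{1+α} where w = y·u^{1+α}. -/
def Phi (p u y : ℝ) : ℝ :=
  |wN p u (y * u ^ (1 + alphac p))| /
    (uN p u (y * u ^ (1 + alphac p))) ^ (1 + alphac p)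

/-- C_p = (p/(p+1))^{1/q}. -/
def Cp (p : ℝ) : ℝ := (p / (p + 1)) ^ (1 / qc p)

/-- D_p = C_p·(p-1)(3p+1)/(2p(p+1)²). -/
def Dp (p : ℝ) : ℝ := Cp p * ((p - 1) * (3 * p + 1)) / (2 * p * (p + 1) ^ 2)

open Filter Topology

/-- `F u` is differentiable near `c` for small `u > 0`, and the values and derivatives of `F`
converge to `a` and `b` as `u → 0⁺` and the second argument tends to `c`. -/
def DerivTendsto (c : ℝ) (F : ℝ → ℝ → ℝ) (a b : ℝ) : Prop :=
  ∃ F' : ℝ × ℝ → ℝ,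
    (∀ᶠ x in 𝓝[>] (0 : ℝ) ×ˢ 𝓝 c, HasDerivAt (F x.1) (F' x) x.2) ∧
    Tendsto (fun x : ℝ × ℝ => F x.1 x.2) (𝓝[>] (0 : ℝ) ×ˢ 𝓝 c) (𝓝 a) ∧
    Tendsto F' (𝓝[>] (0 : ℝ) ×ˢ 𝓝 c) (𝓝 b)

namespace DerivTendsto

variable {c a b a₁ b₁ : ℝ} {F G : ℝ → ℝ → ℝ}

theorem of_left {g : ℝ → ℝ} (hg : Tendsto g (𝓝[>] 0) (𝓝 a)) :
    DerivTendsto c (fun u _ => g u) a 0 :=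
  ⟨fun _ => 0, Eventually.of_forall fun x => hasDerivAt_const x.2 (g x.1),
    hg.comp tendsto_fst, tendsto_const_nhds⟩

theorem const (a : ℝ) : DerivTendsto c (fun _ _ => a) a 0 := of_left tendsto_const_nhds

theorem snd : DerivTendsto c (fun _ y => y) c 1 :=
  ⟨fun _ => 1, Eventually.of_forall fun x => hasDerivAt_id x.2, tendsto_snd, tendsto_const_nhds⟩

theorem add (hF : DerivTendsto c F a b) (hG : DerivTendsto c G a₁ b₁) :
    DerivTendsto c (fun u y => F u y + G u y) (a + a₁) (b + b₁) := by
  obtain ⟨F', h1, h2, h3⟩ := hF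
  obtain ⟨G', k1, k2, k3⟩ := hG
  exact ⟨fun x => F' x + G' x, (h1.and k1).mono fun x hx => hx.1.add hx.2, h2.add k2, h3.add k3⟩

theorem mul (hF : DerivTendsto c F a b) (hG : DerivTendsto c G a₁ b₁) :
    DerivTendsto c (fun u y => F u y * G u y) (a * a₁) (b * a₁ + a * b₁) := by
  obtain ⟨F', h1, h2, h3⟩ := hF
  obtain ⟨G', k1, k2, k3⟩ := hG
  exact ⟨fun x => F' x * G x.1 x.2 + F x.1 x.2 * G' x, (h1.and k1).mono fun x hx => hx.1.mul hx.2,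
    h2.mul k2, (h3.mul k2).add (h2.mul k3)⟩

theorem sub (hF : DerivTendsto c F a b) (hG : DerivTendsto c G a₁ b₁) :
    DerivTendsto c (fun u y => F u y - G u y) (a - a₁) (b - b₁) := by
  obtain ⟨F', h1, h2, h3⟩ := hF
  obtain ⟨G', k1, k2, k3⟩ := hG
  exact ⟨fun x => F' x - G' x, (h1.and k1).mono fun x hx => hx.1.sub hx.2, h2.sub k2, h3.sub k3⟩

theorem div (hF : DerivTendsto c F a b) (hG : DerivTendsto c G a₁ b₁) (h0 : a₁ ≠ 0) :
    DerivTendsto c (fun u y => F u y / G u y) (a / a₁) ((b * a₁ - a * b₁) / a₁ ^ 2) := by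
  obtain ⟨F', h1, h2, h3⟩ := hF
  obtain ⟨G', k1, k2, k3⟩ := hG
  refine ⟨fun x => (F' x * G x.1 x.2 - F x.1 x.2 * G' x) / G x.1 x.2 ^ 2, ?_, h2.div k2 h0,
    ((h3.mul k2).sub (h2.mul k3)).div (k2.pow 2) (pow_ne_zero 2 h0)⟩
  filter_upwards [h1, k1, k2.eventually_ne h0] with x hx hy hz using hx.div hy hz

theorem rpow (hF : DerivTendsto c F a b) (h0 : 0 < a) (r : ℝ) :
    DerivTendsto c (fun u y => F u y ^ r) (a ^ r) (b * r * a ^ (r - 1)) := by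
  obtain ⟨F', h1, h2, h3⟩ := hF
  refine ⟨fun x => F' x * r * F x.1 x.2 ^ (r - 1), ?_, h2.rpow_const (Or.inl h0.ne'),
    (h3.mul_const r).mul (h2.rpow_const (Or.inl h0.ne'))⟩
  filter_upwards [h1, h2.eventually_ne h0.ne'] with x hx hy using hx.rpow_const (Or.inl hy)

theorem abs_of_neg (hF : DerivTendsto c F a b) (h0 : a < 0) :
    DerivTendsto c (fun u y => |F u y|) (-a) (-b) := by
  obtain ⟨F', h1, h2, h3⟩ := hF
  refine ⟨fun x => -F' x, ?_, by simpa [_root_.abs_of_neg h0] using h2.abs, h3.neg⟩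
  filter_upwards [h1, h2.eventually_lt_const h0] with x hx hy
  have := (hasDerivAt_abs_neg hy).comp x.2 hx
  rwa [neg_one_mul] at this

theorem congr (hF : DerivTendsto c F a b)
    (h : ∀ᶠ x in 𝓝[>] (0 : ℝ) ×ˢ 𝓝 c, G x.1 x.2 = F x.1 x.2) : DerivTendsto c G a b := by
  obtain ⟨F', h1, h2, h3⟩ := hF
  refine ⟨F', ?_, h2.congr' (h.mono fun x hx => hx.symm), h3⟩
  obtain ⟨P, hP, Q, hQ, hPQ⟩ := eventually_prod_iff.1 h
  filter_upwards [h1, hP.prod_mk hQ.eventually_nhds] with x hx hy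
  exact hx.congr_of_eventuallyEq (hy.2.mono fun z hz => hPQ hy.1 hz)

/-- The divided difference `((1 + u f) ^ r - 1) / u` extends to `u = 0` by `r f`. -/
theorem rpow_slope (hF : DerivTendsto c F a b) (h0 : 0 < a) (r : ℝ) :
    DerivTendsto c (fun u y => ((1 + u * F u y) ^ r - 1) / u) (r * a) (r * b) := by
  obtain ⟨F', h1, h2, h3⟩ := hF
  have hu : Tendsto (fun x : ℝ × ℝ => x.1) (𝓝[>] (0 : ℝ) ×ˢ 𝓝 c) (𝓝 0) :=
    (tendsto_nhdsWithin_iff.1 tendsto_fst).1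
  have hpos : ∀ᶠ x : ℝ × ℝ in 𝓝[>] (0 : ℝ) ×ˢ 𝓝 c, 0 < x.1 :=
    (tendsto_nhdsWithin_iff.1 tendsto_fst).2
  have ht : Tendsto (fun x : ℝ × ℝ => x.1 * F x.1 x.2) (𝓝[>] (0 : ℝ) ×ˢ 𝓝 c) (𝓝 0) := by
    simpa using hu.mul h2
  have hs : Tendsto (fun x : ℝ × ℝ => 1 + x.1 * F x.1 x.2) (𝓝[>] (0 : ℝ) ×ˢ 𝓝 c) (𝓝 1) := by
    simpa using ht.const_add 1
  refine ⟨fun x => r * (F' x * (1 + x.1 * F x.1 x.2) ^ (r - 1)), ?_, ?_, ?_⟩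
  · filter_upwards [h1, hpos, hs.eventually_ne one_ne_zero] with x hx hx0 hs0
    have h := (hx.const_mul x.1).const_add 1
    refine (((h.rpow_const (p := r) (Or.inl hs0)).sub_const 1).div_const x.1).congr_deriv ?_
    field_simp
  · have hd : HasDerivAt (fun t : ℝ => (1 + t) ^ r) r 0 := by
      have := ((hasDerivAt_id (0 : ℝ)).const_add 1).rpow_const (p := r) (Or.inl (by simp))
      simpa using this
    have hslope := (hasDerivAt_iff_tendsto_slope.1 hd).comp (tendsto_nhdsWithin_iff.2 ⟨ht, by
      filter_upwards [hpos, h2.eventually_const_lt h0] with x hx hy using (mul_pos hx hy).ne'⟩)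
    refine (hslope.mul h2).congr' ?_
    filter_upwards [hpos, h2.eventually_const_lt h0] with x hx hy
    simp only [Function.comp, slope_def_field, add_zero, one_rpow, sub_zero]
    field_simp
  · simpa using (h3.mul (hs.rpow_const (p := r - 1) (Or.inl one_ne_zero))).const_mul r

end DerivTendsto

/-- The quotient `d₁ / u` in the scaled variables. -/
def scaledD1 (p u y : ℝ) : ℝ := ((1 + u * y ^ qc p) ^ (-(1 / p)) - 1) / u + 1

/-- The quotient `-d₂ / u ^ (1 / p)` in the scaled variables. -/
def scaledD2 (p u y : ℝ) : ℝ :=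
  y ^ (qc p - 1) * (1 + u * y ^ qc p) ^ (-(1 / p)) + y * u ^ (2 * alphac p)

/-- The quotient `γ / u ^ (2 α)` in the scaled variables. -/
def scaledGamma (p u y : ℝ) : ℝ :=
  (((1 + u * y ^ qc p) ^ alphac p - 1) / u + 1 + y * y * u ^ (2 * alphac p)) /
    (scaledD2 p u y * scaledD2 p u y +
      u ^ (2 * alphac p) * (scaledD1 p u y * scaledD1 p u y))

theorem Mv_scaled {p u y : ℝ} (hp : 1 < p) (hu : 0 < u) (hy : 0 < y) :
    Mv p u (y * u ^ (1 + alphac p)) = u * (1 + u * y ^ qc p) ^ alphac p := by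
  have hp0 : p ≠ 0 := by linarith
  have hp1 : p - 1 ≠ 0 := by linarith
  have hq : 1 / qc p = alphac p := by unfold qc alphac; field_simp
  have hqa : qc p * alphac p = 1 := by unfold qc alphac; field_simp
  have hs : 0 < 1 + u * y ^ qc p := by positivity
  have : u ^ qc p + |y * u ^ (1 + alphac p)| ^ qc p = u ^ qc p * (1 + u * y ^ qc p) := by
    rw [abs_of_pos (by positivity), mul_rpow hy.le (by positivity), ← rpow_mul hu.le,
      show (1 + alphac p) * qc p = qc p + 1 by linarith, rpow_add hu, rpow_one]
    ring
  rw [Mv, this, hq, mul_rpow (by positivity) hs.le, ← rpow_mul hu.le, hqa, rpow_one]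

theorem Mv_scaled_rpow {p u y : ℝ} (hp : 1 < p) (hu : 0 < u) (hy : 0 < y) :
    Mv p u (y * u ^ (1 + alphac p)) ^ (qc p - 1) =
      u ^ (qc p - 1) * (1 + u * y ^ qc p) ^ (1 / p) := by
  have hp0 : p ≠ 0 := by linarith
  have hp1 : p - 1 ≠ 0 := by linarith
  have hs : 0 < 1 + u * y ^ qc p := by positivity
  rw [Mv_scaled hp hu hy, mul_rpow hu.le (by positivity), ← rpow_mul hs.le,
    show alphac p * (qc p - 1) = 1 / p by unfold qc alphac; field_simp; ring]

theorem d1f_scaled {p u y : ℝ} (hp : 1 < p) (hu : 0 < u) (hy : 0 < y) :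
    d1f p u (y * u ^ (1 + alphac p)) = u * scaledD1 p u y := by
  have hs : 0 < 1 + u * y ^ qc p := by positivity
  rw [d1f, v1f, Mv_scaled_rpow hp hu hy, scaledD1, rpow_neg hs.le]
  field_simp

theorem d2f_scaled {p u y : ℝ} (hp : 1 < p) (hu : 0 < u) (hy : 0 < y) :
    d2f p u (y * u ^ (1 + alphac p)) = -(u ^ (1 / p) * scaledD2 p u y) := by
  have hp0 : p ≠ 0 := by linarith
  have hp1 : p - 1 ≠ 0 := by linarith
  have hs : 0 < 1 + u * y ^ qc p := by positivity
  have hw : 0 < y * u ^ (1 + alphac p) := by positivity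
  rw [d2f, v2f, Mv_scaled_rpow hp hu hy, scaledD2, rpow_neg hs.le, Real.sign_of_pos hw,
    abs_of_pos hw, mul_rpow hy.le (by positivity), ← rpow_mul hu.le,
    show (1 + alphac p) * (qc p - 1) = (qc p - 1) + 1 / p by unfold qc alphac; field_simp; ring,
    rpow_add hu, show 1 + alphac p = 1 / p + 2 * alphac p by unfold alphac; field_simp; ring,
    rpow_add hu]
  field_simp
  ring

theorem gamf_scaled {p u y : ℝ} (hp : 1 < p) (hu : 0 < u) (hy : 0 < y) :
    gamf p u (y * u ^ (1 + alphac p)) = u ^ (2 * alphac p) * scaledGamma p u y := by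
  have hp0 : p ≠ 0 := by linarith
  have hT : 0 < u ^ (1 / p) := by positivity
  have hR : 0 < u ^ (2 * alphac p) := by positivity
  have hRT : u ^ (2 * alphac p) * (u ^ (1 / p)) ^ 2 = u ^ 2 := by
    rw [← rpow_natCast (u ^ (1 / p)), ← rpow_mul hu.le, ← rpow_add hu, ← rpow_natCast u]
    congr 1
    unfold alphac
    push_cast
    field_simp
    ring
  have hw : u ^ (1 + alphac p) = u ^ (2 * alphac p) * u ^ (1 / p) := by
    rw [← rpow_add hu]
    congr 1
    unfold alphac
    field_simp
    ring
  rw [gamf, Mv_scaled hp hu hy, d1f_scaled hp hu hy, d2f_scaled hp hu hy, scaledGamma, hw]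
  set T := u ^ (1 / p)
  set R := u ^ (2 * alphac p)
  set S := (1 + u * y ^ qc p) ^ alphac p
  have hnum : u * S - u + u ^ 2 + (y * (R * T)) ^ 2 =
      T ^ 2 * (R * ((S - 1) / u + 1 + y * y * R)) := by
    have : T ^ 2 * (R * ((S - 1) / u + 1 + y * y * R)) =
      R * T ^ 2 * ((S - 1) / u + 1) + (y * (R * T)) ^ 2 := by ring
    rw [this, hRT]
    field_simp
  have hden : (u * scaledD1 p u y) ^ 2 + (-(T * scaledD2 p u y)) ^ 2 =
      T ^ 2 * (scaledD2 p u y * scaledD2 p u y + R * (scaledD1 p u y * scaledD1 p u y)) := by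
    linear_combination -(scaledD1 p u y) ^ 2 * hRT
  rw [hnum, hden, mul_div_mul_left _ _ (pow_ne_zero 2 hT.ne'), mul_div_assoc]

theorem Phi_scaled {p u y : ℝ} (hp : 1 < p) (hu : 0 < u) (hy : 0 < y)
    (h : 0 < 1 - u ^ (2 * alphac p) * scaledGamma p u y * scaledD1 p u y) :
    Phi p u y = |y - scaledGamma p u y * scaledD2 p u y| /
      (1 - u ^ (2 * alphac p) * scaledGamma p u y * scaledD1 p u y) ^ (1 + alphac p) := by
  have hp0 : p ≠ 0 := by linarith
  have hw : u ^ (1 + alphac p) = u ^ (2 * alphac p) * u ^ (1 / p) := by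
    rw [← rpow_add hu]
    congr 1
    unfold alphac
    field_simp
    ring
  have hU : uN p u (y * u ^ (1 + alphac p)) =
      u * (1 - u ^ (2 * alphac p) * scaledGamma p u y * scaledD1 p u y) := by
    rw [uN, gamf_scaled hp hu hy, d1f_scaled hp hu hy]
    ring
  have hW : wN p u (y * u ^ (1 + alphac p)) =
      u ^ (1 + alphac p) * (y - scaledGamma p u y * scaledD2 p u y) := by
    rw [wN, gamf_scaled hp hu hy, d2f_scaled hp hu hy, hw]
    ring
  have hup : 0 < u ^ (1 + alphac p) := by positivity
  rw [Phi, hU, hW, mul_rpow hu.le h.le, abs_mul, abs_of_pos hup,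
    mul_div_mul_left _ _ hup.ne']

/-- As `u → 0⁺` and `y → C_p`, the map `Φ` tends to `C_p` and `∂Φ/∂y` to `-2 / (p - 1)`. -/
theorem Phi_derivTendsto {p : ℝ} (hp : 1 < p) :
    DerivTendsto (Cp p) (Phi p) (Cp p) (-(2 / (p - 1))) := by
  have hp0 : 0 < p := by linarith
  have hp1 : 0 < p - 1 := by linarith
  have hC : 0 < Cp p := by unfold Cp; positivity
  have ha : 0 < alphac p := by unfold alphac; positivity
  have hu : Tendsto (fun u : ℝ => u) (𝓝[>] 0) (𝓝 0) := tendsto_id.mono_left nhdsWithin_le_nhds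
  have hR : Tendsto (fun u : ℝ => u ^ (2 * alphac p)) (𝓝[>] 0) (𝓝 0) := by
    have := hu.rpow_const (p := 2 * alphac p) (Or.inr (by positivity))
    rwa [zero_rpow (by positivity)] at this
  have hCq : Cp p ^ qc p = p / (p + 1) := by
    have hq : qc p ≠ 0 := by unfold qc; positivity
    rw [Cp, ← rpow_mul (by positivity), one_div_mul_cancel hq, rpow_one]
  have hCq1 : Cp p ^ (qc p - 1) = p / (p + 1) / Cp p := by rw [rpow_sub_one hC.ne', hCq]
  have hCq2 : Cp p ^ (qc p - 1 - 1) = p / (p + 1) / Cp p / Cp p := by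
    rw [rpow_sub_one hC.ne', hCq1]
  have hy : DerivTendsto (Cp p) (fun _ y => y) (Cp p) 1 := .snd
  have hyq := hy.rpow hC (qc p)
  have hr : DerivTendsto (Cp p) (fun u _ => u ^ (2 * alphac p)) 0 0 := .of_left hR
  have hs := (DerivTendsto.const (c := Cp p) 1).add ((DerivTendsto.of_left hu).mul hyq)
  have hD1 : DerivTendsto (Cp p) (scaledD1 p) _ _ :=
    (hyq.rpow_slope (by positivity) (-(1 / p))).add (.const 1)
  have hD2 : DerivTendsto (Cp p) (scaledD2 p) _ _ :=
    ((hy.rpow hC (qc p - 1)).mul (hs.rpow (by simp) (-(1 / p)))).add (hy.mul hr)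
  have hG : DerivTendsto (Cp p) (scaledGamma p) _ _ :=
    (((hyq.rpow_slope (by positivity) (alphac p)).add (.const 1)).add ((hy.mul hy).mul hr)).div
      ((hD2.mul hD2).add (hr.mul (hD1.mul hD1))) (by simp; positivity)
  have hnum := hy.sub (hG.mul hD2)
  have hden := (DerivTendsto.const (c := Cp p) 1).sub ((hr.mul hG).mul hD1)
  simp only [hCq, hCq1, hCq2, mul_zero, zero_mul, add_zero, one_rpow, mul_one, one_mul,
    sub_zero] at hnum hden
  have hnum' : DerivTendsto (Cp p) (fun u y => y - scaledGamma p u y * scaledD2 p u y)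
      (-Cp p) (2 / (p - 1)) := by
    convert hnum using 1
    · unfold alphac
      field_simp
      ring
    · unfold alphac qc
      field_simp
      ring
  have hquot := (hnum'.abs_of_neg (by linarith)).div (hden.rpow one_pos (1 + alphac p)) (by simp)
  simp only [one_rpow, mul_one, mul_zero, zero_mul, sub_zero, neg_neg, div_one, one_pow]
    at hquot
  refine hquot.congr ?_
  obtain ⟨-, -, hlim, -⟩ := hden
  filter_upwards [hlim.eventually_const_lt one_pos,
    (eventually_mem_nhdsWithin (a := (0 : ℝ)) (s := Set.Ioi 0)).prod_mk (eventually_gt_nhds hC)]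
    with x hx hxy
  exact Phi_scaled hp hxy.1 hxy.2 hx

theorem contraction_p_gt_three (p : ℝ) (hp : 3 < p)
    (u₀ : ℝ) (hu₀ : 0 < u₀) (ystar : ℝ → ℝ)
    (hyc : ContinuousOn ystar (Set.Icc 0 u₀))
    (hy0 : ystar 0 = Cp p)
    (hypos : ∀ u ∈ Set.Icc (0:ℝ) u₀, 0 < ystar u)
    (hyfix : ∀ u ∈ Set.Ioc (0:ℝ) u₀, Phi p u (ystar u) = ystar u)
    (hyexp : ∃ C > (0:ℝ), ∀ u ∈ Set.Ioc (0:ℝ) u₀,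
      |ystar u - (Cp p + Dp p * u)| ≤ C * u ^ (2 * alphac p)) :
    ∃ uctr > (0:ℝ), uctr ≤ u₀ ∧ ∃ δ > (0:ℝ), ∃ lam : ℝ, 0 < lam ∧ lam < 1 ∧
      ∀ u ∈ Set.Ioc (0:ℝ) uctr, ∀ y : ℝ, |y - ystar u| ≤ δ →
        |deriv (fun s => Phi p u s) y| ≤ lam := by
  obtain ⟨F', hF, -, hlim⟩ := Phi_derivTendsto (p := p) (by linarith)
  have hlt : |-(2 / (p - 1))| < 1 := by
    rw [abs_neg, abs_of_pos (div_pos two_pos (by linarith)), div_lt_one (by linarith)]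
    linarith
  obtain ⟨lam, hlam, hlam1⟩ := exists_between hlt
  have hev : ∀ᶠ x : ℝ × ℝ in 𝓝[>] (0 : ℝ) ×ˢ 𝓝 (Cp p), |deriv (Phi p x.1) x.2| ≤ lam := by
    filter_upwards [hF, hlim.abs.eventually_lt_const hlam] with x hx hx'
    rw [hx.deriv]
    exact hx'.le
  obtain ⟨P, hP, Q, hQ, hPQ⟩ := eventually_prod_iff.1 hev
  obtain ⟨ε, hε, hεP⟩ := mem_nhdsGT_iff_exists_Ioc_subset.1 hP
  obtain ⟨δ, hδ, hδQ⟩ := Metric.eventually_nhds_iff.1 hQ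
  obtain ⟨η, hη, hηy⟩ := Metric.continuousWithinAt_iff.1
    (hyc 0 (Set.left_mem_Icc.2 hu₀.le)) (δ / 2) (half_pos hδ)
  have hε' : 0 < ε := hε
  refine ⟨min u₀ (min ε (η / 2)), by positivity, min_le_left _ _, δ / 3, by positivity, lam,
    (abs_nonneg _).trans_lt hlam, hlam1, fun u hu y hy => ?_⟩
  obtain ⟨hu0, hu1⟩ := hu
  obtain ⟨h1, h2, h3⟩ : u ≤ u₀ ∧ u ≤ ε ∧ u ≤ η / 2 := by simpa using hu1
  refine hPQ (hεP ⟨hu0, h2⟩) (hδQ ?_)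
  have hclose := hηy ⟨hu0.le, h1⟩ (by rw [Real.dist_eq, sub_zero, abs_of_pos hu0]; linarith)
  rw [hy0, Real.dist_eq] at hclose
  rw [Real.dist_eq]
  calc |y - Cp p| ≤ |y - ystar u| + |ystar u - Cp p| := abs_sub_le _ _ _
    _ < δ := by linarith

end Stmt8
end
end

section
/- Let p = 3 and let Φ(u,y) be the scaled one-step Frank–Wolfe map and y*(u) the fixed-point curve with y*(u) = C₃ + D₃·u + O(u^κ), κ = 4/3. Then for every K₀ > 0 there exist u_ctr > 0 and c > 0 such that for all u ∈ (0, u_ctr] and all y with |y - y*(u)| ≤ K₀·u^κ, one has |∂Φ/∂y(u,y)| ≤ 1 - c·u. -/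
/-!
STATEMENT 9: Marginal contraction of the scaled one-step map for p = 3: in the
tube |y - y*(u)| ≤ K₀·u^κ (κ = 4/3) one has |∂Φ/∂y(u,y)| ≤ 1 - c·u.
-/

noncomputable section
open Real

namespace Stmt9

/-- Hölder conjugate q = p/(p-1). -/
def qc (p : ℝ) : ℝ := p / (p - 1)

/-- α = (p-1)/p = 1/q. -/
def alphac (p : ℝ) : ℝ := (p - 1) / p

/-- M = (u^q + |w|^q)^{1/q}. -/
def Mv (p u w : ℝ) : ℝ := (u ^ qc p + |w| ^ qc p) ^ (1 / qc p)

/-- First coordinate of the LMO output: v₁ = u^{q-1}/M^{q-1}. -/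
def v1f (p u w : ℝ) : ℝ := u ^ (qc p - 1) / Mv p u w ^ (qc p - 1)

/-- Second coordinate of the LMO output: v₂ = -sign(w)·|w|^{q-1}/M^{q-1}. -/
def v2f (p u w : ℝ) : ℝ := -(Real.sign w) * |w| ^ (qc p - 1) / Mv p u w ^ (qc p - 1)

/-- d₁ = v₁ - 1 + u. -/
def d1f (p u w : ℝ) : ℝ := v1f p u w - 1 + u

/-- d₂ = v₂ - w. -/
def d2f (p u w : ℝ) : ℝ := v2f p u w - w

/-- Exact line-search step size γ = (M - u + u² + w²)/(d₁² + d₂²). -/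
def gamf (p u w : ℝ) : ℝ :=
  (Mv p u w - u + u ^ 2 + w ^ 2) / (d1f p u w ^ 2 + d2f p u w ^ 2)

/-- u' = u - γ·d₁. -/
def uN (p u w : ℝ) : ℝ := u - gamf p u w * d1f p u w

/-- w' = w + γ·d₂. -/
def wN (p u w : ℝ) : ℝ := w + gamf p u w * d2f p u w

/-- Scaled one-step map Φ(u,y) = |w'|/(u')^{1+α} where w = y·u^{1+α}. -/
def Phi (p u y : ℝ) : ℝ :=
  |wN p u (y * u ^ (1 + alphac p))| /
    (uN p u (y * u ^ (1 + alphac p))) ^ (1 + alphac p)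

/-- C_p = (p/(p+1))^{1/q}. -/
def Cp (p : ℝ) : ℝ := (p / (p + 1)) ^ (1 / qc p)

/-- D_p = C_p·(p-1)(3p+1)/(2p(p+1)²). -/
def Dp (p : ℝ) : ℝ := Cp p * ((p - 1) * (3 * p + 1)) / (2 * p * (p + 1) ^ 2)

/-- The cube root of `1 + u·y^(3/2)`, in the variables `u = r³`, `y = b²`. -/
def cbrtA (r b : ℝ) : ℝ := (1 + b ^ 3 * r ^ 3) ^ ((1:ℝ) / 3)

/-- The quotient `(a³ - 1) / (a - 1)`. -/
def quadM (r b : ℝ) : ℝ := cbrtA r b ^ 2 + cbrtA r b + 1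

/-- The rescaled first direction component `d₁ / r³`. -/
def scD1 (r b : ℝ) : ℝ := 1 - b ^ 3 / (cbrtA r b * quadM r b)

/-- The rescaled numerator of the step size, divided by `r⁶`. -/
def scNum (r b : ℝ) : ℝ := 1 + b ^ 3 * (cbrtA r b + 1) / quadM r b + b ^ 4 * r ^ 4

/-- The `r⁴`-coefficient of the rescaled denominator of the step size. -/
def denRem (r b : ℝ) : ℝ :=
  2 * cbrtA r b * b + cbrtA r b ^ 2 * b ^ 2 * r ^ 4 + cbrtA r b ^ 2 * scD1 r b ^ 2 / b ^ 2

/-- The rescaled denominator of the step size. -/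
def scDen (r b : ℝ) : ℝ := 1 + r ^ 4 * denRem r b

/-- The relative decrease `(u - u') / u`, divided by `r⁴`. -/
def relDec (r b : ℝ) : ℝ := cbrtA r b ^ 2 * scNum r b * scD1 r b / (b ^ 2 * scDen r b)

/-- The cube root of `u' / u`. -/
def cbrtC (r b : ℝ) : ℝ := (1 - r ^ 4 * relDec r b) ^ ((1:ℝ) / 3)

/-- The expansion of the scaled map to order `u`. -/
def mainPart (r b : ℝ) : ℝ := 1 / b - b ^ 2 / 3 + r ^ 3 * (b ^ 2 / 3 + b ^ 5 / 9)

/-- The remainder of `a · scNum` after its expansion to order `r³`. -/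
def numRem (r b : ℝ) : ℝ :=
  cbrtA r b * b ^ 4 - r ^ 2 * (b ^ 6 * (cbrtA r b + 2) / (3 * quadM r b ^ 2)
    + b ^ 9 * (cbrtA r b ^ 3 + 3 * cbrtA r b ^ 2 + 6 * cbrtA r b + 5) / (9 * quadM r b ^ 3))

/-- The remainder of `-w' / u^(5/3)`. -/
def wRem (r b : ℝ) : ℝ :=
  numRem r b / b
    + cbrtA r b * scNum r b * ((cbrtA r b * b - denRem r b) / scDen r b) / b

/-- The remainder of `(u / u')^(5/3)`. -/
def uRem (r b : ℝ) : ℝ :=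
  relDec r b * (1 + cbrtC r b + cbrtC r b ^ 2 + cbrtC r b ^ 3 + cbrtC r b ^ 4)
    / (cbrtC r b ^ 5 * (1 + cbrtC r b + cbrtC r b ^ 2))

/-- The remainder of the scaled map. -/
def phiRem (r b : ℝ) : ℝ :=
  wRem r b + mainPart r b * uRem r b + r ^ 4 * (wRem r b * uRem r b)

lemma cbrtA_pos {r b : ℝ} (hr : 0 ≤ r) (hb : 0 ≤ b) : 0 < cbrtA r b := by
  unfold cbrtA; positivity

lemma cbrtA_cube {r b : ℝ} (hr : 0 ≤ r) (hb : 0 ≤ b) : cbrtA r b ^ 3 = 1 + b ^ 3 * r ^ 3 := by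
  unfold cbrtA
  rw [← rpow_natCast, ← rpow_mul (by positivity)]
  norm_num

lemma quadM_pos {r b : ℝ} (hr : 0 ≤ r) (hb : 0 ≤ b) : 0 < quadM r b := by
  have := cbrtA_pos hr hb
  unfold quadM; positivity

lemma denRem_nonneg {r b : ℝ} (hr : 0 ≤ r) (hb : 0 ≤ b) : 0 ≤ denRem r b := by
  have := cbrtA_pos hr hb
  unfold denRem; positivity

lemma scDen_pos {r b : ℝ} (hr : 0 ≤ r) (hb : 0 ≤ b) : 0 < scDen r b := by
  have := denRem_nonneg hr hb
  unfold scDen; positivity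

lemma alphac_three : 1 + alphac 3 = 5 / 3 := by norm_num [alphac]

lemma qc_three : qc 3 = 3 / 2 := by norm_num [qc]

lemma scaled_w {r : ℝ} (hr : 0 ≤ r) (b : ℝ) :
    b ^ 2 * (r ^ 3) ^ (1 + alphac 3) = b ^ 2 * r ^ 5 := by
  rw [alphac_three, ← rpow_natCast r 3, ← rpow_mul hr]
  norm_num

lemma Mv_eq {r b : ℝ} (hr : 0 < r) (hb : 0 < b) :
    Mv 3 (r ^ 3) (b ^ 2 * r ^ 5) = r ^ 3 * cbrtA r b ^ 2 := by
  have ha := cbrtA_pos hr.le hb.le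
  have h1 : (r ^ 3) ^ ((3:ℝ) / 2) + (b ^ 2 * r ^ 5) ^ ((3:ℝ) / 2)
      = (r ^ 3 * cbrtA r b ^ 2) ^ ((3:ℝ) / 2) := by
    have e : b ^ 2 * r ^ 5 = r ^ 3 * (b * r) ^ 2 := by ring
    have k : ∀ x : ℝ, 0 ≤ x → (x ^ 2) ^ ((3:ℝ) / 2) = x ^ 3 := by
      intro x hx
      rw [← rpow_natCast x 2, ← rpow_mul hx]
      norm_num
    rw [e, mul_rpow (by positivity) (by positivity), mul_rpow (by positivity) (by positivity),
      k _ (by positivity), k _ ha.le, cbrtA_cube hr.le hb.le]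
    ring
  rw [Mv, qc_three, abs_of_pos (by positivity), h1, ← rpow_mul (by positivity)]
  norm_num

lemma sqrt_Mv {r b : ℝ} (hr : 0 < r) (hb : 0 < b) :
    (r ^ 3 * cbrtA r b ^ 2) ^ ((1:ℝ) / 2) = (r ^ 3) ^ ((1:ℝ) / 2) * cbrtA r b := by
  have ha := cbrtA_pos hr.le hb.le
  rw [mul_rpow (by positivity) (by positivity), ← sqrt_eq_rpow (cbrtA r b ^ 2), sqrt_sq ha.le]

lemma v1f_eq {r b : ℝ} (hr : 0 < r) (hb : 0 < b) :
    v1f 3 (r ^ 3) (b ^ 2 * r ^ 5) = 1 / cbrtA r b := by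
  have ha := cbrtA_pos hr.le hb.le
  rw [v1f, Mv_eq hr hb, qc_three, show (3:ℝ) / 2 - 1 = 1 / 2 by norm_num, sqrt_Mv hr hb]
  have : 0 < (r ^ 3) ^ ((1:ℝ) / 2) := by positivity
  field_simp

lemma v2f_eq {r b : ℝ} (hr : 0 < r) (hb : 0 < b) :
    v2f 3 (r ^ 3) (b ^ 2 * r ^ 5) = -(b * r / cbrtA r b) := by
  have ha := cbrtA_pos hr.le hb.le
  rw [v2f, Mv_eq hr hb, qc_three, show (3:ℝ) / 2 - 1 = 1 / 2 by norm_num, sqrt_Mv hr hb,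
    Real.sign_of_pos (by positivity), abs_of_pos (by positivity),
    show b ^ 2 * r ^ 5 = r ^ 3 * (b * r) ^ 2 by ring, mul_rpow (by positivity) (by positivity),
    ← sqrt_eq_rpow ((b * r) ^ 2), sqrt_sq (by positivity)]
  have : 0 < (r ^ 3) ^ ((1:ℝ) / 2) := by positivity
  field_simp

lemma d1f_eq {r b : ℝ} (hr : 0 < r) (hb : 0 < b) :
    d1f 3 (r ^ 3) (b ^ 2 * r ^ 5) = r ^ 3 * scD1 r b := by
  have ha := cbrtA_pos hr.le hb.le
  have hm := quadM_pos hr.le hb.le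
  have h3 : (cbrtA r b - 1) * quadM r b = b ^ 3 * r ^ 3 := by
    unfold quadM
    linear_combination cbrtA_cube hr.le hb.le
  rw [d1f, v1f_eq hr hb, scD1]
  field_simp
  linear_combination -h3

lemma d2f_eq {r b : ℝ} (hr : 0 < r) (hb : 0 < b) :
    d2f 3 (r ^ 3) (b ^ 2 * r ^ 5) = -(b * r / cbrtA r b * (1 + cbrtA r b * b * r ^ 4)) := by
  have ha := cbrtA_pos hr.le hb.le
  rw [d2f, v2f_eq hr hb]
  field_simp
  ring

lemma gamf_eq {r b : ℝ} (hr : 0 < r) (hb : 0 < b) :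
    gamf 3 (r ^ 3) (b ^ 2 * r ^ 5)
      = r ^ 4 * (cbrtA r b ^ 2 * scNum r b / (b ^ 2 * scDen r b)) := by
  have ha := cbrtA_pos hr.le hb.le
  have hm := quadM_pos hr.le hb.le
  have hE := scDen_pos hr.le hb.le
  have h3 : (cbrtA r b - 1) * quadM r b = b ^ 3 * r ^ 3 := by
    unfold quadM
    linear_combination cbrtA_cube hr.le hb.le
  have hnum : r ^ 3 * cbrtA r b ^ 2 - r ^ 3 + (r ^ 3) ^ 2 + (b ^ 2 * r ^ 5) ^ 2
      = r ^ 6 * scNum r b := by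
    unfold scNum
    field_simp
    linear_combination (cbrtA r b + 1) * h3
  have hden : (r ^ 3 * scD1 r b) ^ 2
      + (-(b * r / cbrtA r b * (1 + cbrtA r b * b * r ^ 4))) ^ 2
      = b ^ 2 * r ^ 2 / cbrtA r b ^ 2 * scDen r b := by
    unfold scDen denRem
    field_simp
    ring
  rw [gamf, Mv_eq hr hb, d1f_eq hr hb, d2f_eq hr hb, hnum, hden]
  field_simp

lemma uN_eq {r b : ℝ} (hr : 0 < r) (hb : 0 < b) :
    uN 3 (r ^ 3) (b ^ 2 * r ^ 5) = r ^ 3 * (1 - r ^ 4 * relDec r b) := by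
  rw [uN, gamf_eq hr hb, d1f_eq hr hb, relDec]
  ring

lemma cbrtA_mul_scNum {r b : ℝ} (hr : 0 < r) (hb : 0 < b) :
    cbrtA r b * scNum r b
      = 1 + 2 * b ^ 3 / 3 + r ^ 3 * (b ^ 3 / 3 + b ^ 6 / 9) + r ^ 4 * numRem r b := by
  have hm := quadM_pos hr.le hb.le
  have hr3 : r ^ 3 = (cbrtA r b ^ 3 - 1) / b ^ 3 := by
    rw [cbrtA_cube hr.le hb.le]
    field_simp
    ring
  have hsplit : 1 + 2 * b ^ 3 / 3 + r ^ 3 * (b ^ 3 / 3 + b ^ 6 / 9) + r ^ 4 * numRem r b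
      = 1 + 2 * b ^ 3 / 3 + r ^ 3 * (b ^ 3 / 3 + b ^ 6 / 9) + r ^ 4 * (cbrtA r b * b ^ 4)
        - (r ^ 3) ^ 2 * (b ^ 6 * (cbrtA r b + 2) / (3 * quadM r b ^ 2)
    + b ^ 9 * (cbrtA r b ^ 3 + 3 * cbrtA r b ^ 2 + 6 * cbrtA r b + 5) / (9 * quadM r b ^ 3)) := by
    unfold numRem; ring
  rw [hsplit, hr3]
  unfold scNum
  field_simp
  unfold quadM
  ring

lemma wN_eq {r b : ℝ} (hr : 0 < r) (hb : 0 < b) :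
    wN 3 (r ^ 3) (b ^ 2 * r ^ 5) = -(r ^ 5 * (mainPart r b + r ^ 4 * wRem r b)) := by
  have ha := cbrtA_pos hr.le hb.le
  have hE := scDen_pos hr.le hb.le
  have hV : (1 + cbrtA r b * b * r ^ 4) / scDen r b
      = 1 + r ^ 4 * ((cbrtA r b * b - denRem r b) / scDen r b) := by
    field_simp
    unfold scDen
    ring
  have hw : wN 3 (r ^ 3) (b ^ 2 * r ^ 5) = b ^ 2 * r ^ 5
      - r ^ 5 * (cbrtA r b * scNum r b / b * ((1 + cbrtA r b * b * r ^ 4) / scDen r b)) := by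
    rw [wN, gamf_eq hr hb, d2f_eq hr hb]
    field_simp
    ring
  have hN : cbrtA r b * scNum r b / b
      = mainPart r b + b ^ 2 + r ^ 4 * (numRem r b / b) := by
    rw [cbrtA_mul_scNum hr hb, mainPart]
    field_simp
    ring
  rw [hw, hV, wRem]
  linear_combination (-r ^ 5) * hN

lemma Phi_eq {r b : ℝ} (hr : 0 < r) (hb : 0 < b) (hu : 0 < 1 - r ^ 4 * relDec r b)
    (hw : 0 < mainPart r b + r ^ 4 * wRem r b) :
    Phi 3 (r ^ 3) (b ^ 2) = mainPart r b + r ^ 4 * phiRem r b := by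
  have hc : 0 < cbrtC r b := by unfold cbrtC; positivity
  have hc3 : cbrtC r b ^ 3 = 1 - r ^ 4 * relDec r b := by
    unfold cbrtC
    rw [← rpow_natCast, ← rpow_mul hu.le]
    norm_num
  have hpow : (r ^ 3 * (1 - r ^ 4 * relDec r b)) ^ ((5:ℝ) / 3) = r ^ 5 * cbrtC r b ^ 5 := by
    rw [← hc3, ← mul_pow, ← mul_pow, ← rpow_natCast _ 3, ← rpow_mul (by positivity)]
    norm_num
  have hY : 1 / cbrtC r b ^ 5 = 1 + r ^ 4 * uRem r b := by
    have : r ^ 4 * uRem r b = (1 - cbrtC r b ^ 3)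
        * (1 + cbrtC r b + cbrtC r b ^ 2 + cbrtC r b ^ 3 + cbrtC r b ^ 4)
        / (cbrtC r b ^ 5 * (1 + cbrtC r b + cbrtC r b ^ 2)) := by
      rw [show 1 - cbrtC r b ^ 3 = r ^ 4 * relDec r b by linarith, uRem]
      ring
    rw [this]
    field_simp
    ring
  rw [Phi, scaled_w hr.le, wN_eq hr hb, uN_eq hr hb, abs_neg, abs_of_pos (by positivity),
    alphac_three, hpow, mul_div_mul_left _ _ (by positivity), div_eq_mul_one_div, hY, phiRem]
  ring

section Smoothness

variable {b : ℝ}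

lemma cbrtA_zero (b : ℝ) : cbrtA 0 b = 1 := by simp [cbrtA]

lemma quadM_zero (b : ℝ) : quadM 0 b = 3 := by norm_num [quadM, cbrtA_zero]

lemma scDen_zero (b : ℝ) : scDen 0 b = 1 := by simp [scDen]

lemma cbrtC_zero (b : ℝ) : cbrtC 0 b = 1 := by simp [cbrtC]

lemma contDiffAt_cbrtA (b : ℝ) : ContDiffAt ℝ 1 (fun x : ℝ × ℝ => cbrtA x.1 x.2) (0, b) := by
  unfold cbrtA
  exact ContDiffAt.rpow_const_of_ne (by fun_prop) (by simp)

lemma contDiffAt_quadM (b : ℝ) : ContDiffAt ℝ 1 (fun x : ℝ × ℝ => quadM x.1 x.2) (0, b) := by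
  have := contDiffAt_cbrtA b
  unfold quadM
  fun_prop

lemma contDiffAt_scD1 (b : ℝ) : ContDiffAt ℝ 1 (fun x : ℝ × ℝ => scD1 x.1 x.2) (0, b) := by
  have := contDiffAt_cbrtA b
  have := contDiffAt_quadM b
  unfold scD1
  fun_prop (disch := simp [cbrtA_zero, quadM_zero])

lemma contDiffAt_scNum (b : ℝ) : ContDiffAt ℝ 1 (fun x : ℝ × ℝ => scNum x.1 x.2) (0, b) := by
  have := contDiffAt_cbrtA b
  have := contDiffAt_quadM b
  unfold scNum
  fun_prop (disch := simp [quadM_zero])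

lemma contDiffAt_denRem (hb : b ≠ 0) :
    ContDiffAt ℝ 1 (fun x : ℝ × ℝ => denRem x.1 x.2) (0, b) := by
  have := contDiffAt_cbrtA b
  have := contDiffAt_scD1 b
  unfold denRem
  fun_prop (disch := simp [hb])

lemma contDiffAt_scDen (hb : b ≠ 0) :
    ContDiffAt ℝ 1 (fun x : ℝ × ℝ => scDen x.1 x.2) (0, b) := by
  have := contDiffAt_denRem hb
  unfold scDen
  fun_prop

lemma contDiffAt_relDec (hb : b ≠ 0) :
    ContDiffAt ℝ 1 (fun x : ℝ × ℝ => relDec x.1 x.2) (0, b) := by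
  have := contDiffAt_cbrtA b
  have := contDiffAt_scNum b
  have := contDiffAt_scD1 b
  have := contDiffAt_scDen hb
  unfold relDec
  fun_prop (disch := simp [hb, scDen_zero])

lemma contDiffAt_cbrtC (hb : b ≠ 0) :
    ContDiffAt ℝ 1 (fun x : ℝ × ℝ => cbrtC x.1 x.2) (0, b) := by
  have := contDiffAt_relDec hb
  unfold cbrtC
  exact ContDiffAt.rpow_const_of_ne (by fun_prop) (by simp)

lemma contDiffAt_mainPart (hb : b ≠ 0) :
    ContDiffAt ℝ 1 (fun x : ℝ × ℝ => mainPart x.1 x.2) (0, b) := by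
  unfold mainPart
  fun_prop (disch := simp [hb])

lemma contDiffAt_numRem (b : ℝ) : ContDiffAt ℝ 1 (fun x : ℝ × ℝ => numRem x.1 x.2) (0, b) := by
  have := contDiffAt_cbrtA b
  have := contDiffAt_quadM b
  unfold numRem
  fun_prop (disch := simp [quadM_zero])

lemma contDiffAt_wRem (hb : b ≠ 0) :
    ContDiffAt ℝ 1 (fun x : ℝ × ℝ => wRem x.1 x.2) (0, b) := by
  have := contDiffAt_cbrtA b
  have := contDiffAt_scNum b
  have := contDiffAt_numRem b
  have := contDiffAt_denRem hb
  have := contDiffAt_scDen hb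
  unfold wRem
  fun_prop (disch := simp [scDen_zero])

lemma contDiffAt_uRem (hb : b ≠ 0) :
    ContDiffAt ℝ 1 (fun x : ℝ × ℝ => uRem x.1 x.2) (0, b) := by
  have := contDiffAt_relDec hb
  have := contDiffAt_cbrtC hb
  unfold uRem
  fun_prop (disch := norm_num [cbrtC_zero])

lemma contDiffAt_phiRem (hb : b ≠ 0) :
    ContDiffAt ℝ 1 (fun x : ℝ × ℝ => phiRem x.1 x.2) (0, b) := by
  have := contDiffAt_wRem hb
  have := contDiffAt_uRem hb
  have := contDiffAt_mainPart hb
  unfold phiRem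
  fun_prop

end Smoothness

section Derivative

open Filter Topology

lemma hasDerivAt_mainPart (r : ℝ) {b : ℝ} (hb : b ≠ 0) :
    HasDerivAt (mainPart r) (-1 / b ^ 2 - 2 * b / 3 + r ^ 3 * (2 * b / 3 + 5 * b ^ 4 / 9)) b := by
  unfold mainPart
  have h := (((hasDerivAt_id b).fun_inv hb).sub ((hasDerivAt_pow 2 b).div_const 3)).add
    ((((hasDerivAt_pow 2 b).div_const 3).add ((hasDerivAt_pow 5 b).div_const 9)).const_mul (r ^ 3))
  simp only [id] at h
  refine (h.congr_deriv ?_).congr_of_eventuallyEq (.of_forall fun x => ?_)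
  · norm_num
  · simp

/-- The derivative of the scaled map, up to an error of order `r⁴`. -/
lemma exists_deriv_Phi_bound {b₀ : ℝ} (hb₀ : 0 < b₀) (h3 : b₀ ^ 3 < 3) :
    ∃ ε > 0, ∃ K ≥ 0, ∀ r b : ℝ, 0 < r → r < ε → |b - b₀| < ε → 0 < b →
      |deriv (fun s => Phi 3 (r ^ 3) s) (b ^ 2)
        - (-1 / (2 * b ^ 3) - 1 / 3 + r ^ 3 * (1 / 3 + 5 * b ^ 3 / 18))| ≤ K * r ^ 4 := by
  have hφ := contDiffAt_phiRem hb₀.ne'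
  set φ : ℝ × ℝ → ℝ := fun x => phiRem x.1 x.2
  have hdiff : ∀ᶠ x in 𝓝 ((0:ℝ), b₀), DifferentiableAt ℝ φ x :=
    (hφ.eventually (by simp)).mono fun x hx => hx.differentiableAt (by simp)
  have hbound : ∀ᶠ x in 𝓝 ((0:ℝ), b₀), ‖fderiv ℝ φ x‖ < ‖fderiv ℝ φ (0, b₀)‖ + 1 :=
    (hφ.continuousAt_fderiv (by simp)).norm.eventually_lt continuousAt_const (by simp)
  have hu : ∀ᶠ x in 𝓝 ((0:ℝ), b₀), 0 < 1 - x.1 ^ 4 * relDec x.1 x.2 := by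
    have hc : ContinuousAt (fun x : ℝ × ℝ => relDec x.1 x.2) (0, b₀) :=
      (contDiffAt_relDec hb₀.ne').continuousAt
    have hc' : ContinuousAt (fun x : ℝ × ℝ => 1 - x.1 ^ 4 * relDec x.1 x.2) (0, b₀) := by
      fun_prop
    exact continuousAt_const.eventually_lt hc' (by simp)
  have hw : ∀ᶠ x in 𝓝 ((0:ℝ), b₀), 0 < mainPart x.1 x.2 + x.1 ^ 4 * wRem x.1 x.2 := by
    have hc : ContinuousAt (fun x : ℝ × ℝ => wRem x.1 x.2) (0, b₀) :=
      (contDiffAt_wRem hb₀.ne').continuousAt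
    have hm : ContinuousAt (fun x : ℝ × ℝ => mainPart x.1 x.2) (0, b₀) :=
      (contDiffAt_mainPart hb₀.ne').continuousAt
    have hc' : ContinuousAt
        (fun x : ℝ × ℝ => mainPart x.1 x.2 + x.1 ^ 4 * wRem x.1 x.2) (0, b₀) := by
      fun_prop
    refine continuousAt_const.eventually_lt hc' ?_
    have : 1 / b₀ - b₀ ^ 2 / 3 = (3 - b₀ ^ 3) / (3 * b₀) := by field_simp
    have : 0 < (3 - b₀ ^ 3) / (3 * b₀) := div_pos (by linarith) (by positivity)
    simp only [mainPart]
    norm_num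
    norm_num at *
    linarith
  obtain ⟨ε, hε, hball⟩ := Metric.eventually_nhds_iff.1
    (hdiff.and (hbound.and (hu.and hw)).eventually_nhds)
  refine ⟨min ε (b₀ / 2), by positivity, (‖fderiv ℝ φ (0, b₀)‖ + 1) / b₀, by positivity, ?_⟩
  intro r b hr hrε hbε hb
  have hbhalf : b₀ / 2 < b := by
    have := (abs_lt.1 (hbε.trans_le (min_le_right _ _))).1
    linarith
  obtain ⟨hd, hev⟩ := @hball (r, b) (by
    rw [Prod.dist_eq, max_lt_iff, Real.dist_eq, Real.dist_eq, sub_zero, abs_of_pos hr]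
    exact ⟨hrε.trans_le (min_le_left _ _), hbε.trans_le (min_le_left _ _)⟩)
  have hK := hev.self_of_nhds.1
  set d := fderiv ℝ φ (r, b) (0, 1)
  have hdK : |d| ≤ ‖fderiv ℝ φ (0, b₀)‖ + 1 := by
    have h := (fderiv ℝ φ (r, b)).le_opNorm ((0:ℝ), (1:ℝ))
    have hn : ‖((0:ℝ), (1:ℝ))‖ = 1 := by simp [Prod.norm_def]
    rw [hn, mul_one] at h
    exact h.trans hK.le
  have hderiv : HasDerivAt (fun β => phiRem r β) d b :=
    hd.hasFDerivAt.comp_hasDerivAt b ((hasDerivAt_const b r).prodMk (hasDerivAt_id b))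
  have hG := (hasDerivAt_mainPart r hb.ne').add (hderiv.const_mul (r ^ 4))
  have hsq : √(b ^ 2) = b := sqrt_sq hb.le
  have hsqrt := Real.hasDerivAt_sqrt (pow_pos hb 2).ne'
  have hcomp := HasDerivAt.comp (b ^ 2) (by rw [hsq]; exact hG) hsqrt
  have heq : (fun s => Phi 3 (r ^ 3) s) =ᶠ[𝓝 (b ^ 2)]
      ((mainPart r + fun β => r ^ 4 * phiRem r β) ∘ Real.sqrt) := by
    have hcont : Tendsto (fun s : ℝ => (r, √s)) (𝓝 (b ^ 2)) (𝓝 (r, b)) := by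
      have : ContinuousAt (fun s : ℝ => (r, √s)) (b ^ 2) := by fun_prop
      simpa [ContinuousAt, hsq] using this
    filter_upwards [hcont.eventually hev, lt_mem_nhds (pow_pos hb 2)] with s hs hs0
    have := Phi_eq hr (sqrt_pos.2 hs0) hs.2.1 hs.2.2
    rw [sq_sqrt hs0.le] at this
    simpa using this
  rw [heq.deriv_eq, hcomp.deriv, hsq]
  have hsimp : (-1 / b ^ 2 - 2 * b / 3 + r ^ 3 * (2 * b / 3 + 5 * b ^ 4 / 9) + r ^ 4 * d)
        * (1 / (2 * b)) - (-1 / (2 * b ^ 3) - 1 / 3 + r ^ 3 * (1 / 3 + 5 * b ^ 3 / 18))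
      = d / (2 * b) * r ^ 4 := by
    field_simp
    ring
  rw [hsimp, abs_mul, abs_of_pos (pow_pos hr 4), abs_div, abs_of_pos (by positivity : 0 < 2 * b)]
  gcongr
  linarith

lemma hasDerivAt_leadingSlope {b₀ : ℝ} (hb₀ : 0 < b₀) :
    HasDerivAt (fun y => -1 / (2 * √y ^ 3) - 1 / 3) (3 / (4 * b₀ ^ 5)) (b₀ ^ 2) := by
  have hsq : √(b₀ ^ 2) = b₀ := sqrt_sq hb₀.le
  have h := ((((Real.hasDerivAt_sqrt (pow_pos hb₀ 2).ne').pow 3).const_mul 2).fun_inv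
    (by simp only [Pi.pow_apply]; rw [hsq]; positivity)).const_mul (-1) |>.sub_const (1 / 3)
  simp only [Pi.pow_apply, hsq] at h
  refine (h.congr_deriv ?_).congr_of_eventuallyEq (.of_forall fun x => ?_)
  · field_simp
    norm_num
    ring
  · simp [div_eq_mul_inv]

/-- First-order behaviour of the slope along `y = b₀² + O(u)`, for every tolerance `η`. -/
lemma exists_slope_bound {b₀ ε η : ℝ} (hb₀ : 0 < b₀) (h3 : b₀ ^ 3 = 3 / 4) (hε : 0 < ε)
    (hη : 0 < η) :
    ∃ δ > 0, ∀ y : ℝ, |y - b₀ ^ 2| < δ → 0 < y ∧ |√y - b₀| < ε ∧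
      |(-1 / (2 * √y ^ 3) - 1 / 3) + 1 - 3 / (4 * b₀ ^ 5) * (y - b₀ ^ 2)| ≤ η * |y - b₀ ^ 2| ∧
      |(1 / 3 + 5 * √y ^ 3 / 18) - 13 / 24| ≤ η := by
  have hsq : √(b₀ ^ 2) = b₀ := sqrt_sq hb₀.le
  have h1 := (hasDerivAt_leadingSlope hb₀).isLittleO.def hη
  have h2 : ∀ᶠ y in 𝓝 (b₀ ^ 2), |√y - b₀| < ε := by
    have hc : ContinuousAt (fun y => |√y - b₀|) (b₀ ^ 2) := by fun_prop
    exact hc.eventually_lt continuousAt_const (by simpa [hsq] using hε)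
  have hq : ∀ᶠ y in 𝓝 (b₀ ^ 2), |(1 / 3 + 5 * √y ^ 3 / 18) - 13 / 24| < η := by
    have hc : ContinuousAt (fun y => |(1 / 3 + 5 * √y ^ 3 / 18) - 13 / 24|) (b₀ ^ 2) := by
      fun_prop
    refine hc.eventually_lt continuousAt_const ?_
    rw [hsq, h3]
    norm_num [hη]
  obtain ⟨δ, hδ, h⟩ := Metric.eventually_nhds_iff.1
    ((lt_mem_nhds (pow_pos hb₀ 2)).and (h2.and (h1.and hq)))
  refine ⟨δ, hδ, fun y hy => ?_⟩
  obtain ⟨ha, hb, hc, hd⟩ := h (show dist y (b₀ ^ 2) < δ from hy)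
  refine ⟨ha, hb, ?_, hd.le⟩
  rw [Real.norm_eq_abs, Real.norm_eq_abs, hsq, h3, smul_eq_mul] at hc
  convert hc using 2
  ring

end Derivative

theorem contraction_p_eq_three
    (u₀ : ℝ) (hu₀ : 0 < u₀) (ystar : ℝ → ℝ)
    (hyc : ContinuousOn ystar (Set.Icc 0 u₀))
    (hy0 : ystar 0 = Cp 3)
    (hypos : ∀ u ∈ Set.Icc (0:ℝ) u₀, 0 < ystar u)
    (hyfix : ∀ u ∈ Set.Ioc (0:ℝ) u₀, Phi 3 u (ystar u) = ystar u)
    (hyexp : ∃ C > (0:ℝ), ∀ u ∈ Set.Ioc (0:ℝ) u₀,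
      |ystar u - (Cp 3 + Dp 3 * u)| ≤ C * u ^ ((4:ℝ) / 3)) :
    ∀ K₀ > (0:ℝ), ∃ uctr > (0:ℝ), uctr ≤ u₀ ∧ ∃ c > (0:ℝ),
      ∀ u ∈ Set.Ioc (0:ℝ) uctr, ∀ y : ℝ, |y - ystar u| ≤ K₀ * u ^ ((4:ℝ) / 3) →
        |deriv (fun s => Phi 3 u s) y| ≤ 1 - c * u := by
  intro K₀ hK₀
  obtain ⟨C, hC, hexp⟩ := hyexp
  set b₀ : ℝ := (3 / 4 : ℝ) ^ ((1:ℝ) / 3) with hb₀def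
  have hb₀ : 0 < b₀ := by positivity
  have h3 : b₀ ^ 3 = 3 / 4 := by
    rw [hb₀def, ← rpow_natCast, ← rpow_mul (by norm_num)]
    norm_num
  have hCp : Cp 3 = b₀ ^ 2 := by
    rw [Cp, qc_three, hb₀def, ← rpow_natCast, ← rpow_mul (by norm_num)]
    norm_num
  have hDp : Dp 3 = 5 * b₀ ^ 2 / 24 := by
    rw [Dp, hCp]
    ring
  obtain ⟨ε, hε, K, hK, hderiv⟩ := exists_deriv_Phi_bound hb₀ (by rw [h3]; norm_num)
  set L := C + K₀ with hL
  set B := 5 * b₀ ^ 2 / 24 + L with hB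
  have hBpos : 0 < B := by positivity
  set p₁ := 3 / (4 * b₀ ^ 5) with hp₁
  have hp₁pos : 0 < p₁ := by positivity
  have hp₁D : p₁ * (5 * b₀ ^ 2 / 24) = 5 / 24 := by
    have : p₁ * (5 * b₀ ^ 2 / 24) = 5 / 32 / b₀ ^ 3 := by
      rw [hp₁]; field_simp; norm_num
    rw [this, h3]; norm_num
  obtain ⟨δ, hδ, hslope⟩ := exists_slope_bound (η := 1 / (8 * (B + 1))) hb₀ h3 hε (by positivity)
  set ρ := min (min ε 1) (min (δ / B) (1 / (8 * (p₁ * L + K + 1)))) with hρ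
  have hρpos : 0 < ρ := by positivity
  refine ⟨min ((ρ / 2) ^ 3) u₀, by positivity, min_le_right _ _, 1 / 2, by norm_num, ?_⟩
  rintro u ⟨hu0, hu⟩ y hy
  obtain ⟨r, hr, hru⟩ : ∃ r : ℝ, 0 < r ∧ r ^ 3 = u :=
    ⟨u ^ ((1:ℝ) / 3), by positivity, by
      rw [← rpow_natCast, ← rpow_mul hu0.le]
      norm_num⟩
  have hrρ : r < ρ := by
    have h := lt_of_pow_lt_pow_left₀ (a := r) (b := ρ) 3 hρpos.le
    refine h ?_
    rw [hru]
    refine (hu.trans (min_le_left _ _)).trans_lt ?_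
    gcongr
    linarith
  have hrε : r < ε := hrρ.trans_le ((min_le_left _ _).trans (min_le_left _ _))
  have hr1 : r < 1 := hrρ.trans_le ((min_le_left _ _).trans (min_le_right _ _))
  have hrδ : r * B < δ :=
    (lt_div_iff₀ hBpos).1 (hrρ.trans_le ((min_le_right _ _).trans (min_le_left _ _)))
  have hrK : r * (8 * (p₁ * L + K + 1)) < 1 :=
    (lt_div_iff₀ (by positivity)).1
      (hrρ.trans_le ((min_le_right _ _).trans (min_le_right _ _)))
  have hu43 : u ^ ((4:ℝ) / 3) = r ^ 4 := by
    rw [← hru, ← rpow_natCast r 3, ← rpow_mul hr.le]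
    norm_num
  have hstar := hexp u ⟨hu0, hu.trans (min_le_right _ _)⟩
  rw [hu43] at hy hstar
  rw [hCp, hDp] at hstar
  have hu_lt : u < 1 := by rw [← hru]; exact pow_lt_one₀ hr.le hr1 (by norm_num)
  have hu_le : u ≤ r := by
    rw [← hru]; exact pow_le_of_le_one hr.le hr1.le (by norm_num)
  have hr4 : r ^ 4 = u * r := by rw [← hru]; ring
  rw [hr4] at hy hstar
  set e := y - b₀ ^ 2 - 5 * b₀ ^ 2 / 24 * u with he
  have heL : |e| ≤ L * (u * r) := by
    have h : e = (y - ystar u) + (ystar u - (b₀ ^ 2 + 5 * b₀ ^ 2 / 24 * u)) := by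
      rw [he]; ring
    rw [h]
    refine (abs_add_le _ _).trans ?_
    rw [hL]
    linarith
  have hur : u * r ≤ u := mul_le_of_le_one_right hu0.le hr1.le
  have hyB : |y - b₀ ^ 2| ≤ B * u := by
    have h : y - b₀ ^ 2 = 5 * b₀ ^ 2 / 24 * u + e := by rw [he]; ring
    rw [h]
    refine (abs_add_le _ _).trans ?_
    rw [abs_of_pos (by positivity : 0 < 5 * b₀ ^ 2 / 24 * u), hB, add_mul]
    have : L * (u * r) ≤ L * u := by gcongr
    linarith
  have hyδ : |y - b₀ ^ 2| < δ := by
    refine hyB.trans_lt (lt_of_le_of_lt ?_ hrδ)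
    rw [mul_comm]
    gcongr
  obtain ⟨hy_pos, hbε, hp, hq⟩ := hslope y hyδ
  have hd := hderiv r (√y) hr hrε hbε (sqrt_pos.2 hy_pos)
  rw [sq_sqrt hy_pos.le, hru, hr4] at hd
  set P := -1 / (2 * √y ^ 3) - 1 / 3
  set Q := 1 / 3 + 5 * √y ^ 3 / 18
  set η := 1 / (8 * (B + 1)) with hη
  have hη_pos : 0 < η := by positivity
  have hηB : η * (B + 1) = 1 / 8 := by rw [hη]; field_simp
  have hp' : |P + 1 - p₁ * (y - b₀ ^ 2)| ≤ η * (B * u) := hp.trans (by gcongr)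
  have hq' : |u * (Q - 13 / 24)| ≤ u * η := by
    rw [abs_mul, abs_of_pos hu0]
    gcongr
  have he' : |p₁ * e| ≤ p₁ * (L * (u * r)) := by
    rw [abs_mul, abs_of_pos hp₁pos]
    gcongr
  have hsmall : u * (r * (8 * (p₁ * L + K + 1))) ≤ u * 1 := by gcongr
  have hur0 : 0 < u * r := by positivity
  have hy_split : p₁ * (y - b₀ ^ 2) = 5 / 24 * u + p₁ * e := by
    rw [he]; linear_combination u * hp₁D
  have hηu : η * (B * u) + u * η = u / 8 := by linear_combination u * hηB
  rw [hy_split] at hp'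
  obtain ⟨hp₁', hp₂'⟩ := abs_le.1 hp'
  obtain ⟨hq₁', hq₂'⟩ := abs_le.1 hq'
  obtain ⟨he₁', he₂'⟩ := abs_le.1 he'
  obtain ⟨hd₁, hd₂⟩ := abs_le.1 hd
  exact abs_le.2 ⟨by linarith, by linarith⟩

end Stmt9
end
end
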